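/- arXiv:1604.08029 — 2 statements merged into one kernel-verified Lean document; each statement's English description precedes it below -/
import Mathlib

section
/- In the boundary setting described in the context, for every j ≤ 2n − 1 the tangential-normal second derivative satisfies |∂²u/∂t_j ∂x_n (P)| ≤ C, where C depends only on n, m, sup_Ω |u|, sup_Ω |∇u|, h, χ, α and ∂Ω. -/
open scoped BigOperators ContDiff ComplexOrder
open Metric

noncomputable section

/-- `ℂ^n` with the Euclidean metric. -/
abbrev Cn (n : ℕ) := EuclideanSpace ℂ (Fin n)

/-- The `k`-th elementary symmetric polynomial `S_k`. -/
def esymm {n : ℕ} (k : ℕ) (lam : Fin n → ℝ) : ℝ :=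
  ∑ s ∈ Finset.univ.powersetCard k, ∏ i ∈ s, lam i

/-- The cone `Γ_m = {λ : S_1(λ) > 0, …, S_m(λ) > 0}`. -/
def GammaCone (n m : ℕ) : Set (Fin n → ℝ) :=
  {lam | ∀ k, 1 ≤ k → k ≤ m → 0 < esymm k lam}

/-- `lam` is the tuple of eigenvalues of `a⁻¹ g` (i.e. of `g` with respect to the
Hermitian metric `a`): the roots of `det (g - t a) = 0`, counted with multiplicity. -/
def IsEigenvalues {n : ℕ} (a g : Matrix (Fin n) (Fin n) ℂ) (lam : Fin n → ℝ) : Prop :=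
  ∀ t : ℝ, (g - (t : ℂ) • a).det = a.det * ∏ i, ((lam i : ℂ) - (t : ℂ))

/-- Wirtinger derivative `∂f/∂z_i` relative to a set `s`. -/
def wderOn {n : ℕ} (s : Set (Cn n)) (i : Fin n) (f : Cn n → ℂ) (z : Cn n) : ℂ :=
  (fderivWithin ℝ f s z (EuclideanSpace.single i 1)
    - Complex.I * fderivWithin ℝ f s z (EuclideanSpace.single i Complex.I)) / 2

/-- Conjugate Wirtinger derivative `∂f/∂z̄_i` relative to a set `s`. -/
def wderBarOn {n : ℕ} (s : Set (Cn n)) (i : Fin n) (f : Cn n → ℂ) (z : Cn n) : ℂ :=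
  (fderivWithin ℝ f s z (EuclideanSpace.single i 1)
    + Complex.I * fderivWithin ℝ f s z (EuclideanSpace.single i Complex.I)) / 2

/-- Complex Hessian `∂²u/∂z_i ∂z̄_j` of a real-valued function, relative to a set `s`. -/
def cHessOn {n : ℕ} (s : Set (Cn n)) (u : Cn n → ℝ) (i j : Fin n) (z : Cn n) : ℂ :=
  wderOn s i (wderBarOn s j fun w => (u w : ℂ)) z

/-- The matrix `g_{i j̄} = χ_{i j̄} + ∂²u/∂z_i ∂z̄_j`. -/
def gMatOn {n : ℕ} (s : Set (Cn n)) (χ : Cn n → Matrix (Fin n) (Fin n) ℂ) (u : Cn n → ℝ)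
    (z : Cn n) : Matrix (Fin n) (Fin n) ℂ :=
  Matrix.of fun i j => χ z i j + cHessOn s u i j z

/-- `α` is a smooth Hermitian metric on `S`. -/
def IsHermitianMetricOn {n : ℕ} (α : Cn n → Matrix (Fin n) (Fin n) ℂ) (S : Set (Cn n)) : Prop :=
  (∀ i j, ContDiffOn ℝ ∞ (fun z => α z i j) S) ∧ ∀ z ∈ S, (α z).PosDef

/-- `χ` is a smooth real `(1,1)`-form on `S`. -/
def IsRealFormOn {n : ℕ} (χ : Cn n → Matrix (Fin n) (Fin n) ℂ) (S : Set (Cn n)) : Prop :=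
  (∀ i j, ContDiffOn ℝ ∞ (fun z => χ z i j) S) ∧ ∀ z ∈ S, (χ z).IsHermitian

/-- `u` is admissible and solves `S_m(λ(A(u))) = f` on `S`; derivatives are taken
relative to the set `s`. -/
def IsAdmissibleSolutionOn {n : ℕ} (m : ℕ) (α χ : Cn n → Matrix (Fin n) (Fin n) ℂ)
    (s : Set (Cn n)) (u f : Cn n → ℝ) (S : Set (Cn n)) : Prop :=
  ∀ z ∈ S, ∃ lam : Fin n → ℝ, IsEigenvalues (α z) (gMatOn s χ u z) lam ∧
    lam ∈ GammaCone n m ∧ esymm m lam = f z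


/-- Second order real directional derivative (first in direction `v`, then in direction `w`)
relative to the set `s`. -/
def D2On {n : ℕ} (s : Set (Cn n)) (u : Cn n → ℝ) (v w : Cn n) (z : Cn n) : ℝ :=
  fderivWithin ℝ (fun x => fderivWithin ℝ u s x v) s z w

/-! ### Elementary symmetric polynomials on the cone `Γ_m` -/

section ElementarySymmetric

open Polynomial

/-- The polynomial `∏_{i ∈ s} (1 + f_i X)`, whose coefficients are the elementary symmetric
polynomials of `(f_i)_{i ∈ s}`. -/
def linProd {R ι : Type*} [CommRing R] (s : Finset ι) (f : ι → R) : R[X] :=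
  ∏ i ∈ s, (1 + C (f i) * X)

theorem esymm_eq_coeff {n : ℕ} (k : ℕ) (lam : Fin n → ℝ) :
    esymm k lam = (linProd Finset.univ lam).coeff k := by
  unfold esymm linProd
  rw [Finset.prod_one_add, Polynomial.finsetSum_coeff,
    Finset.powersetCard_eq_filter, Finset.sum_filter]
  refine Finset.sum_congr rfl fun s _ => ?_
  rw [Finset.prod_mul_distrib, Finset.prod_const, ← map_prod, coeff_C_mul, coeff_X_pow]
  rcases eq_or_ne s.card k with hs | hs
  · simp [hs]
  · simp [hs, hs.symm]

theorem linProd_coeff_zero {R ι : Type*} [CommRing R] (s : Finset ι) (f : ι → R) :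
    (linProd s f).coeff 0 = 1 := by
  simp [linProd, coeff_zero_prod]

theorem natDegree_linProd_le {R ι : Type*} [CommRing R] (s : Finset ι) (f : ι → R) :
    (linProd s f).natDegree ≤ s.card := by
  refine (natDegree_prod_le _ _).trans ?_
  refine (Finset.sum_le_card_nsmul _ _ 1 fun i _ => ?_).trans (by simp)
  compute_degree

theorem map_linProd {R S ι : Type*} [CommRing R] [CommRing S] (φ : R →+* S) (s : Finset ι)
    (f : ι → R) : (linProd s f).map φ = linProd s (fun i => φ (f i)) := by
  simp [linProd, Polynomial.map_prod]

theorem linProd_eq_mul_erase {R ι : Type*} [CommRing R] [DecidableEq ι] {s : Finset ι}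
    (f : ι → R) {i : ι} (hi : i ∈ s) :
    linProd s f = (1 + C (f i) * X) * linProd (s.erase i) f :=
  (Finset.mul_prod_erase s _ hi).symm

theorem linProd_coeff_succ {R ι : Type*} [CommRing R] [DecidableEq ι] {s : Finset ι}
    (f : ι → R) {i : ι} (hi : i ∈ s) (k : ℕ) :
    (linProd s f).coeff (k + 1) =
      (linProd (s.erase i) f).coeff (k + 1) + f i * (linProd (s.erase i) f).coeff k := by
  rw [linProd_eq_mul_erase f hi, add_mul, one_mul, mul_assoc, coeff_add, coeff_C_mul,
    coeff_X_mul]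

theorem derivative_linProd {R ι : Type*} [CommRing R] [DecidableEq ι] (s : Finset ι)
    (f : ι → R) : derivative (linProd s f) = ∑ i ∈ s, C (f i) * linProd (s.erase i) f := by
  unfold linProd
  rw [derivative_prod_finset]
  exact Finset.sum_congr rfl fun i _ => by
    rw [derivative_add, derivative_one, derivative_C_mul_X, zero_add, mul_comm]

/-- Euler's identity `∑ λ_i ∂S_m/∂λ_i = m S_m`. -/
theorem sum_mul_linProd_erase_coeff {R ι : Type*} [CommRing R] [DecidableEq ι] (s : Finset ι)
    (f : ι → R) (k : ℕ) :
    ∑ i ∈ s, f i * (linProd (s.erase i) f).coeff k = (k + 1) * (linProd s f).coeff (k + 1) := by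
  have h := congrArg (fun p => p.coeff k) (derivative_linProd s f)
  simp only [coeff_derivative, finsetSum_coeff, coeff_C_mul] at h
  rw [← h]; ring

theorem sum_linProd_erase_coeff {ι : Type*} [DecidableEq ι] (s : Finset ι)
    (f : ι → ℝ) (k : ℕ) :
    ∑ i ∈ s, (linProd (s.erase i) f).coeff k = (s.card - k) * (linProd s f).coeff k := by
  rcases k with _ | k
  · simp [linProd_coeff_zero]
  · have h : ∀ i ∈ s, (linProd (s.erase i) f).coeff (k + 1) =
        (linProd s f).coeff (k + 1) - f i * (linProd (s.erase i) f).coeff k := fun i hi => by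
      rw [linProd_coeff_succ f hi]; ring
    rw [Finset.sum_congr rfl h, Finset.sum_sub_distrib, sum_mul_linProd_erase_coeff]
    simp; ring

theorem splits_linProd {ι : Type*} (s : Finset ι) (f : ι → ℝ) : (linProd s f).Splits := by
  refine Splits.prod fun i _ => Splits.of_natDegree_le_one ?_
  compute_degree

theorem splits_derivative_of_splits {p : ℝ[X]} (hp : p.Splits) : (derivative p).Splits := by
  by_cases h0 : p.natDegree = 0
  · rw [eq_C_of_natDegree_eq_zero h0]; simp
  · rw [splits_iff_card_roots] at hp ⊢
    have h1 := card_roots_le_derivative p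
    have h2 := card_roots' (derivative p)
    have h3 := natDegree_derivative p
    omega

/-- Laguerre's inequality for real-rooted polynomials. -/
theorem laguerre_inequality {p : ℝ[X]} (hp : p.Splits) (x : ℝ) :
    p.eval x * (derivative (derivative p)).eval x ≤ (derivative p).eval x ^ 2 := by
  induction hp using Submonoid.closure_induction with
  | mem q hq =>
    rcases hq with ⟨a, rfl⟩ | ⟨a, rfl⟩ <;> simp
  | one => simp
  | mul p q _ _ hp hq =>
    simp only [derivative_mul, derivative_add, eval_add, eval_mul]
    nlinarith [mul_le_mul_of_nonneg_left hp (sq_nonneg (q.eval x)),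
      mul_le_mul_of_nonneg_left hq (sq_nonneg (p.eval x))]

/-- A weak form of Newton's inequalities for the coefficients of a real-rooted polynomial. -/
theorem newton_coeff_inequality {p : ℝ[X]} (hp : p.Splits) (k : ℕ) :
    (k + 2) * (p.coeff k * p.coeff (k + 2)) ≤ (k + 1) * p.coeff (k + 1) ^ 2 := by
  have hs : ∀ k, (derivative^[k] p).Splits := fun k => by
    induction k with
    | zero => exact hp
    | succ k ih => rw [Function.iterate_succ_apply']; exact splits_derivative_of_splits ih
  have h := laguerre_inequality (hs k) 0
  simp only [← Function.iterate_succ_apply' derivative, ← coeff_zero_eq_eval_zero,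
    coeff_iterate_derivative, zero_add, Nat.descFactorial_self, nsmul_eq_mul] at h
  simp only [Nat.succ_eq_add_one, Nat.factorial_succ] at h
  push_cast at h
  have hk : (0 : ℝ) < (k.factorial : ℝ) ^ 2 * (k + 1) := by positivity
  refine le_of_mul_le_mul_left ?_ hk
  nlinarith [h]

theorem newton_weak {ι : Type*} (s : Finset ι) (f : ι → ℝ) (k : ℕ)
    (h0 : 0 < (linProd s f).coeff k) (h2 : 0 < (linProd s f).coeff (k + 2)) :
    (linProd s f).coeff k * (linProd s f).coeff (k + 2) ≤ (linProd s f).coeff (k + 1) ^ 2 := by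
  have h := newton_coeff_inequality (splits_linProd s f) k
  have hk : (0 : ℝ) ≤ k := k.cast_nonneg
  have hp := mul_pos h0 h2
  have : (k + 1 : ℝ) * ((linProd s f).coeff k * (linProd s f).coeff (k + 2)) ≤
      (k + 1) * (linProd s f).coeff (k + 1) ^ 2 := by nlinarith
  exact le_of_mul_le_mul_left this (by positivity)

/-- On `Γ_m` the first derivatives `∂S_{k+1}/∂λ_i`, `k < m`, are positive. -/
theorem linProd_erase_coeff_pos {ι : Type*} [DecidableEq ι] {s : Finset ι} {f : ι → ℝ} {m : ℕ}
    (hf : ∀ k, 1 ≤ k → k ≤ m → 0 < (linProd s f).coeff k) {i : ι} (hi : i ∈ s) :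
    ∀ k, k < m → 0 < (linProd (s.erase i) f).coeff k := by
  intro k
  induction k with
  | zero => intro _; simp [linProd_coeff_zero]
  | succ k ih =>
    intro hk
    have hpos := ih (by omega)
    by_contra! hneg
    have e1 := hf (k + 1) (by omega) (by omega)
    have e2 := hf (k + 2) (by omega) (by omega)
    rw [linProd_coeff_succ f hi] at e1
    rw [show k + 2 = (k + 1) + 1 from rfl, linProd_coeff_succ f hi] at e2
    set a := (linProd (s.erase i) f).coeff k
    set b := (linProd (s.erase i) f).coeff (k + 1)
    set c := (linProd (s.erase i) f).coeff (k + 1 + 1) with hc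
    have hfi : 0 < f i := by
      by_contra! hfi
      nlinarith [mul_nonpos_of_nonpos_of_nonneg hfi hpos.le]
    have hcpos : 0 < c := by nlinarith
    have hN := newton_weak (s.erase i) f k hpos hcpos
    change a * c ≤ b ^ 2 at hN
    have h1 : a * (-f i * b) ≤ a * c := mul_le_mul_of_nonneg_left (by linarith) hpos.le
    rcases hneg.lt_or_eq with hb | hb
    · have h2 : (-b) * (-b) < (-b) * (f i * a) := mul_lt_mul_of_pos_left (by linarith) (by linarith)
      nlinarith
    · rw [hb] at hN; nlinarith [mul_pos hpos hcpos]

/-- On `Γ_m`, a lower bound on `S_m` yields one on `S_{m-1}`. -/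
theorem min_one_le_linProd_coeff {ι : Type*} {s : Finset ι} {f : ι → ℝ} {m : ℕ}
    (hf : ∀ k, 1 ≤ k → k ≤ m + 1 → 0 < (linProd s f).coeff k) :
    min 1 ((linProd s f).coeff (m + 1)) ≤ (linProd s f).coeff m := by
  induction m with
  | zero => simp [linProd_coeff_zero]
  | succ m ih =>
    have ih := ih fun k h1 h2 => hf k h1 (by omega)
    have h0 : 0 < (linProd s f).coeff m := by
      rcases m with _ | m
      · simp [linProd_coeff_zero]
      · exact hf _ (by omega) (by omega)
    have h1 := hf (m + 1) (by omega) (by omega)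
    have h2 := hf (m + 2) (by omega) (by omega)
    have hN := newton_weak s f m h0 h2
    by_contra! hlt
    obtain ⟨ha, hb⟩ := lt_min_iff.mp hlt
    rw [min_eq_right ha.le] at ih
    change _ < (linProd s f).coeff (m + 2) at hb
    nlinarith

end ElementarySymmetric

/-! ### Sesquilinear forms and simultaneous diagonalization -/

section LinearAlgebra

open Polynomial Matrix
open scoped MatrixOrder Matrix.Norms.L2Operator

/-- The sesquilinear form `∑ M_{i j̄} v_i w̄_j` of a matrix `M`. -/
def sform {n : ℕ} (M : Matrix (Fin n) (Fin n) ℂ) (v w : Cn n) : ℂ :=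
  ∑ i, ∑ j, M i j * v i * star (w j)

theorem sform_eq_dotProduct {n : ℕ} (M : Matrix (Fin n) (Fin n) ℂ) (v w : Cn n) :
    sform M v w = v.ofLp ⬝ᵥ M *ᵥ star w.ofLp := by
  simp only [sform, dotProduct, mulVec, Finset.mul_sum, Pi.star_apply]
  exact Finset.sum_congr rfl fun i _ => Finset.sum_congr rfl fun j _ => by ring

theorem sform_add_left {n : ℕ} (M : Matrix (Fin n) (Fin n) ℂ) (v v' w : Cn n) :
    sform M (v + v') w = sform M v w + sform M v' w := by
  simp [sform_eq_dotProduct, add_dotProduct]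

theorem sform_smul_left {n : ℕ} (M : Matrix (Fin n) (Fin n) ℂ) (r : ℂ) (v w : Cn n) :
    sform M (r • v) w = r * sform M v w := by
  simp [sform_eq_dotProduct, smul_dotProduct]

theorem sform_add {n : ℕ} (M N : Matrix (Fin n) (Fin n) ℂ) (v w : Cn n) :
    sform (M + N) v w = sform M v w + sform N v w := by
  simp [sform_eq_dotProduct, add_mulVec, dotProduct_add]

theorem norm_sform_le {n : ℕ} {M : Matrix (Fin n) (Fin n) ℂ} {K : ℝ}
    (hM : ∀ i j, ‖M i j‖ ≤ K) (v w : Cn n) : ‖sform M v w‖ ≤ n ^ 2 * K * ‖v‖ * ‖w‖ := by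
  have hK : ∀ i j, ‖M i j * v i * star (w j)‖ ≤ K * ‖v‖ * ‖w‖ := fun i j => by
    rw [norm_mul, norm_mul, norm_star]
    have hK0 : 0 ≤ K := (norm_nonneg _).trans (hM i j)
    gcongr
    · exact hM i j
    · exact PiLp.norm_apply_le v i
    · exact PiLp.norm_apply_le w j
  calc ‖sform M v w‖ ≤ ∑ _i : Fin n, ∑ _j : Fin n, K * ‖v‖ * ‖w‖ :=
        (norm_sum_le _ _).trans (Finset.sum_le_sum fun i _ =>
          (norm_sum_le _ _).trans (Finset.sum_le_sum fun j _ => hK i j))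
    _ = n ^ 2 * K * ‖v‖ * ‖w‖ := by simp; ring

/-- `b` is a basis orthonormal for `a` and diagonalizing `g`, with eigenvalues `mu`. -/
structure IsDiagFrame {n : ℕ} (a g : Matrix (Fin n) (Fin n) ℂ) (b : Fin n → Cn n)
    (mu : Fin n → ℝ) : Prop where
  orth : ∀ i j, sform a (b i) (b j) = if i = j then 1 else 0
  diag : ∀ v j, sform g v (b j) = mu j * sform a v (b j)
  span : ∀ N : Cn n, (∀ i, inner ℂ N (b i) = 0) → N = 0

theorem Matrix.IsHermitian.exists_unitary_diagonal {n : ℕ}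
    {H : Matrix (Fin n) (Fin n) ℂ} (hH : H.IsHermitian) :
    ∃ (U : Matrix (Fin n) (Fin n) ℂ) (mu : Fin n → ℝ),
      Uᴴ * U = 1 ∧ H = U * (diagonal fun i => (mu i : ℂ)) * Uᴴ := by
  refine ⟨(hH.eigenvectorUnitary : Matrix (Fin n) (Fin n) ℂ), hH.eigenvalues,
    Unitary.coe_star_mul_self hH.eigenvectorUnitary, ?_⟩
  have hsp := hH.spectral_theorem
  rw [Unitary.conjStarAlgAut_apply] at hsp
  exact hsp

theorem exists_congr_diagonal {n : ℕ} {a g : Matrix (Fin n) (Fin n) ℂ} (ha : a.PosDef)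
    (hg : g.IsHermitian) : ∃ (B : Matrix (Fin n) (Fin n) ℂ) (mu : Fin n → ℝ),
      IsUnit B ∧ Bᴴ * a * B = 1 ∧ Bᴴ * g * B = diagonal fun i => (mu i : ℂ) := by
  obtain ⟨S, hS, rfl⟩ : ∃ S : Matrix (Fin n) (Fin n) ℂ, IsUnit S ∧ a = Sᴴ * S := by
    obtain ⟨S, hS⟩ := CStarAlgebra.nonneg_iff_eq_star_mul_self.mp ha.posSemidef.nonneg
    refine ⟨S, ?_, hS⟩
    have := ha.isUnit
    rw [hS] at this
    exact isUnit_of_mul_isUnit_right this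
  have hdet := (Matrix.isUnit_iff_isUnit_det S).mp hS
  have hH : ((S⁻¹)ᴴ * g * S⁻¹).IsHermitian := isHermitian_conjTranspose_mul_mul _ hg
  obtain ⟨U, mu, hUU, hsp⟩ := hH.exists_unitary_diagonal
  have hUunit : IsUnit U := IsUnit.of_mul_eq_one_right _ hUU
  refine ⟨S⁻¹ * U, mu, ((Matrix.isUnit_nonsing_inv_iff).mpr hS).mul hUunit, ?_, ?_⟩
  · have h1 : (S⁻¹)ᴴ * Sᴴ = 1 := by
      rw [← conjTranspose_mul, Matrix.mul_nonsing_inv _ hdet, conjTranspose_one]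
    calc (S⁻¹ * U)ᴴ * (Sᴴ * S) * (S⁻¹ * U)
        = Uᴴ * ((S⁻¹)ᴴ * Sᴴ) * (S * S⁻¹) * U := by
          rw [conjTranspose_mul]; simp only [Matrix.mul_assoc]
      _ = 1 := by rw [h1, Matrix.mul_nonsing_inv _ hdet, mul_one, mul_one, hUU]
  · calc (S⁻¹ * U)ᴴ * g * (S⁻¹ * U) = Uᴴ * ((S⁻¹)ᴴ * g * S⁻¹) * U := by
          rw [conjTranspose_mul]; simp only [Matrix.mul_assoc]
      _ = (Uᴴ * U) * (diagonal fun i => (mu i : ℂ)) * (Uᴴ * U) := by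
          rw [hsp]; simp only [Matrix.mul_assoc]
      _ = _ := by rw [hUU, one_mul, mul_one]

/-- The conjugates of the columns of a matrix. -/
def conjCol {n : ℕ} (B : Matrix (Fin n) (Fin n) ℂ) (i : Fin n) : Cn n :=
  WithLp.toLp 2 fun k => star (B k i)

theorem congr_apply_eq_sform {n : ℕ} (M B : Matrix (Fin n) (Fin n) ℂ) (i j : Fin n) :
    (Bᴴ * M * B) i j = sform M (conjCol B i) (conjCol B j) := by
  simp only [Matrix.mul_apply, Finset.sum_mul, sform, conjCol, conjTranspose_apply, star_star]
  rw [Finset.sum_comm]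
  exact Finset.sum_congr rfl fun k _ => Finset.sum_congr rfl fun l _ => by ring

theorem isDiagFrame_conjCol {n : ℕ} {a g B : Matrix (Fin n) (Fin n) ℂ} {mu : Fin n → ℝ}
    (hB : IsUnit B) (ha : Bᴴ * a * B = 1) (hg : Bᴴ * g * B = diagonal fun i => (mu i : ℂ)) :
    IsDiagFrame a g (conjCol B) mu where
  orth i j := by rw [← congr_apply_eq_sform, ha, Matrix.one_apply]
  diag v j := by
    have hBH : IsUnit Bᴴ := hB.star
    have key : g * B = a * B * diagonal fun i => (mu i : ℂ) := by
      refine hBH.mul_left_cancel ?_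
      rw [← Matrix.mul_assoc, hg, ← Matrix.mul_assoc, ← Matrix.mul_assoc, ha, one_mul]
    have e : ∀ M : Matrix (Fin n) (Fin n) ℂ, sform M v (conjCol B j) = ∑ k, v k * (M * B) k j := by
      intro M
      simp only [sform, conjCol, Matrix.mul_apply, Finset.mul_sum, star_star]
      exact Finset.sum_congr rfl fun i _ => Finset.sum_congr rfl fun j _ => by ring
    rw [e, e, key, Finset.mul_sum]
    exact Finset.sum_congr rfl fun i _ => by rw [Matrix.mul_diagonal]; ring
  span N hN := by
    have h0 : Bᴴ *ᵥ (star N.ofLp) = 0 := by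
      funext i
      have := hN i
      simp only [PiLp.inner_apply, RCLike.inner_apply, conjCol] at this
      simpa [mulVec, dotProduct] using this
    have h1 : star N.ofLp = 0 := by
      have hBH : IsUnit Bᴴ := hB.star
      exact Matrix.mulVec_injective_iff_isUnit.mpr hBH (by simpa using h0)
    have h2 : N.ofLp = 0 := by simpa using h1
    exact (WithLp.ofLp_injective 2) (by simpa using h2)

theorem det_add_smul_of_isEigenvalues {n : ℕ} {a g : Matrix (Fin n) (Fin n) ℂ}
    {lam : Fin n → ℝ} (h : IsEigenvalues a g lam) (t : ℝ) :
    (a + (t : ℂ) • g).det =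
      a.det * (linProd Finset.univ fun i => (lam i : ℂ)).eval (t : ℂ) := by
  simp only [linProd, eval_prod, eval_add, eval_one, eval_mul, eval_C, eval_X]
  rcases eq_or_ne t 0 with rfl | ht
  · simp
  · have ht' : (t : ℂ) ≠ 0 := by exact_mod_cast ht
    have e := h (-t⁻¹)
    have : a + (t : ℂ) • g = (t : ℂ) • (g - ((-t⁻¹ : ℝ) : ℂ) • a) := by
      push_cast
      rw [smul_sub, smul_smul, mul_neg, mul_inv_cancel₀ ht']
      simp [add_comm]
    rw [this, det_smul, e, Fintype.card_fin, mul_left_comm]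
    congr 1
    rw [← Fin.prod_const, ← Finset.prod_mul_distrib]
    refine Finset.prod_congr rfl fun i _ => ?_
    push_cast
    field_simp
    ring

theorem linProd_eq_of_isEigenvalues {n : ℕ} {a g B : Matrix (Fin n) (Fin n) ℂ}
    {lam mu : Fin n → ℝ} (h : IsEigenvalues a g lam) (ha : Bᴴ * a * B = 1)
    (hg : Bᴴ * g * B = diagonal fun i => (mu i : ℂ)) :
    linProd Finset.univ mu = linProd Finset.univ lam := by
  have key : ∀ t : ℝ, (linProd Finset.univ mu).eval t = (linProd Finset.univ lam).eval t := by
    intro t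
    have e1 : Bᴴ * (a + (t : ℂ) • g) * B = diagonal fun i => 1 + (mu i : ℂ) * (t : ℂ) := by
      rw [Matrix.mul_add, Matrix.add_mul, ha, Matrix.mul_smul, Matrix.smul_mul, hg,
        ← diagonal_one, ← diagonal_smul, diagonal_add]
      congr 1
      funext i
      simp [mul_comm]
    have e2 := congrArg det e1
    rw [det_mul, det_mul, det_add_smul_of_isEigenvalues h, det_diagonal] at e2
    have e3 := congrArg det ha
    rw [det_mul, det_mul, det_one] at e3
    have e4 : (linProd Finset.univ fun i => (lam i : ℂ)).eval (t : ℂ) =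
        ∏ i, (1 + (mu i : ℂ) * (t : ℂ)) := by
      rw [← e2]
      linear_combination (-(linProd Finset.univ fun i => (lam i : ℂ)).eval (t : ℂ)) * e3
    simp only [linProd, eval_prod, eval_add, eval_one, eval_mul, eval_C, eval_X] at e4 ⊢
    exact_mod_cast e4.symm
  exact Polynomial.funext key

end LinearAlgebra

/-! ### The linearized equation -/

section Linearization

open Polynomial Matrix

theorem hasDerivAt_det_of_diagonal {n : ℕ} {M : ℝ → Matrix (Fin n) (Fin n) ℂ}
    {M' : Matrix (Fin n) (Fin n) ℂ} {d : Fin n → ℂ}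
    (hM : ∀ i j, HasDerivAt (fun s => M s i j) (M' i j) 0) (h0 : M 0 = diagonal d) :
    HasDerivAt (fun s => (M s).det) (∑ i, (∏ j ∈ Finset.univ.erase i, d j) * M' i i) 0 := by
  simp only [det_apply']
  have key : ∀ σ : Equiv.Perm (Fin n), HasDerivAt (fun s => ∏ i, M s (σ i) i)
      (∑ i, (∏ j ∈ Finset.univ.erase i, M 0 (σ j) j) * M' (σ i) i) 0 := fun σ => by
    simpa using HasDerivAt.fun_finsetProd (u := Finset.univ) fun i _ => hM (σ i) i
  have hsum := HasDerivAt.fun_sum (u := Finset.univ)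
    fun σ (_ : σ ∈ (Finset.univ : Finset (Equiv.Perm (Fin n)))) =>
      (key σ).const_mul ((Equiv.Perm.sign σ : ℤ) : ℂ)
  refine hsum.congr_deriv ?_
  rw [Finset.sum_eq_single_of_mem (1 : Equiv.Perm (Fin n)) (Finset.mem_univ _)]
  · simp [h0]
  · intro σ _ hσ
    rw [mul_eq_zero]; right
    refine Finset.sum_eq_zero fun i _ => ?_
    rw [mul_eq_zero]; left
    obtain ⟨j, hj, hji⟩ : ∃ j, σ j ≠ j ∧ j ≠ i := by
      by_contra! hcon
      obtain ⟨k, hk⟩ : ∃ k, σ k ≠ k := by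
        by_contra! h; exact hσ (Equiv.ext h)
      have hki := hcon k hk
      have h2 := hcon (σ k) fun h => hk (σ.injective h)
      exact hk (h2.trans hki.symm)
    exact Finset.prod_eq_zero (Finset.mem_erase.mpr ⟨hji, Finset.mem_univ _⟩)
      (by rw [h0, diagonal_apply_ne _ hj])

/-- Every coefficient of a polynomial of degree at most `n` is a fixed linear combination of its
values at `0, 1, …, n`. -/
theorem exists_coeff_eq_sum_eval (n m : ℕ) : ∃ w : ℕ → ℂ, ∀ p : ℂ[X], p.natDegree ≤ n →
    p.coeff m = ∑ j ∈ Finset.range (n + 1), w j * p.eval (j : ℂ) := by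
  refine ⟨fun j => (Lagrange.basis (Finset.range (n + 1)) (fun j : ℕ => (j : ℂ)) j).coeff m,
    fun p hp => ?_⟩
  have h := Lagrange.eq_interpolate (s := Finset.range (n + 1)) (v := fun j : ℕ => (j : ℂ))
    (f := p) (fun a _ b _ hab => Nat.cast_injective hab)
    (by rw [Finset.card_range]; exact degree_lt_iff_coeff_zero _ _ |>.mpr fun k hk =>
          coeff_eq_zero_of_natDegree_lt (by omega))
  conv_lhs => rw [h]
  simp only [Lagrange.interpolate_apply, finsetSum_coeff, coeff_C_mul]
  exact Finset.sum_congr rfl fun j _ => mul_comm _ _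

theorem hasDerivAt_coeff_linProd {n m : ℕ} {p : ℝ → ℂ[X]} {q : ℂ[X]}
    (hp : ∀ s, (p s).natDegree ≤ n) (hq : q.natDegree ≤ n)
    (h : ∀ t : ℝ, HasDerivAt (fun s => (p s).eval (t : ℂ)) (q.eval (t : ℂ)) 0) :
    HasDerivAt (fun s => (p s).coeff m) (q.coeff m) 0 := by
  obtain ⟨w, hw⟩ := exists_coeff_eq_sum_eval n m
  simp only [fun s => hw (p s) (hp s), hw q hq]
  exact HasDerivAt.fun_sum fun j _ => (by simpa using h j : HasDerivAt _ _ _).const_mul (w j)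

/-- Differentiation of `S_m(λ(a⁻¹ g))` along a curve, in a diagonalizing frame. -/
theorem hasDerivAt_esymm_eigenvalues {n k : ℕ} {a g : ℝ → Matrix (Fin n) (Fin n) ℂ}
    {a' g' B : Matrix (Fin n) (Fin n) ℂ} {mu : Fin n → ℝ} {f : ℝ → ℝ} {f' : ℝ}
    (ha : ∀ i j, HasDerivAt (fun s => a s i j) (a' i j) 0)
    (hg : ∀ i j, HasDerivAt (fun s => g s i j) (g' i j) 0)
    (hadet : ∀ᶠ s in nhds 0, (a s).det ≠ 0)
    (hB : IsUnit B) (ha0 : Bᴴ * a 0 * B = 1)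
    (hg0 : Bᴴ * g 0 * B = diagonal fun i => (mu i : ℂ))
    (hlam : ∀ᶠ s in nhds 0, ∃ lam, IsEigenvalues (a s) (g s) lam ∧ esymm (k + 1) lam = f s)
    (hf : HasDerivAt f f' 0) :
    f' = ∑ i, (linProd (Finset.univ.erase i) mu).coeff k *
      ((sform g' (conjCol B i) (conjCol B i)).re -
        mu i * (sform a' (conjCol B i) (conjCol B i)).re) := by
  classical
  have hcong : ∀ {M : ℝ → Matrix (Fin n) (Fin n) ℂ} {M' : Matrix (Fin n) (Fin n) ℂ},
      (∀ i j, HasDerivAt (fun s => M s i j) (M' i j) 0) →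
      ∀ i j, HasDerivAt (fun s => (Bᴴ * M s * B) i j) ((Bᴴ * M' * B) i j) 0 := by
    intro M M' hM i j
    simp only [Matrix.mul_apply, Finset.sum_mul]
    exact HasDerivAt.fun_sum fun k _ => HasDerivAt.fun_sum fun l _ =>
      ((hM l k).const_mul _).mul_const _
  choose! lam hl1 hl2 using fun s
    (hs : ∃ lam, IsEigenvalues (a s) (g s) lam ∧ esymm (k + 1) lam = f s) => hs
  set a1 := Bᴴ * a' * B with ha1
  set g1 := Bᴴ * g' * B with hg1
  set q : ℂ[X] := ∑ i, C (g1 i i - mu i * a1 i i) *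
    (X * linProd (Finset.univ.erase i) fun j => (mu j : ℂ)) with hq
  have hqdeg : q.natDegree ≤ n := by
    refine natDegree_sum_le_of_forall_le _ _ fun i _ => ?_
    refine (natDegree_C_mul_le _ _).trans (natDegree_mul_le.trans ?_)
    have h1 := natDegree_linProd_le (Finset.univ.erase i) fun j => (mu j : ℂ)
    rw [Finset.card_erase_of_mem (Finset.mem_univ i), Finset.card_univ, Fintype.card_fin] at h1
    have h2 := natDegree_X_le (R := ℂ)
    have h3 := i.pos
    omega
  have hder : ∀ t : ℝ, HasDerivAt
      (fun s => (linProd Finset.univ fun i => (lam s i : ℂ)).eval (t : ℂ)) (q.eval (t : ℂ)) 0 := by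
    intro t
    have d1 := hasDerivAt_det_of_diagonal (d := fun i => 1 + (mu i : ℂ) * (t : ℂ))
      (M := fun s => Bᴴ * a s * B + (t : ℂ) • (Bᴴ * g s * B)) (M' := a1 + (t : ℂ) • g1)
      (fun i j => (hcong ha i j).add ((hcong hg i j).const_mul (t : ℂ))) (by
        simp only [ha0, hg0]
        rw [← diagonal_one, ← diagonal_smul, diagonal_add]
        congr 1
        funext i
        simp [mul_comm])
    have d2 := hasDerivAt_det_of_diagonal (d := fun _ => 1)
      (M := fun s => Bᴴ * a s * B) (M' := a1) (hcong ha) (by rw [ha0, diagonal_one])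
    have hne : (Bᴴ * a 0 * B).det ≠ 0 := by rw [ha0]; simp
    have d3 := d1.div d2 hne
    have heq : (fun s => (linProd Finset.univ fun i => (lam s i : ℂ)).eval (t : ℂ)) =ᶠ[nhds 0]
        (fun s => (Bᴴ * a s * B + (t : ℂ) • (Bᴴ * g s * B)).det) /
          fun s => (Bᴴ * a s * B).det := by
      filter_upwards [hlam, hadet] with s hs hs'
      have hBdet : B.det ≠ 0 := ((Matrix.isUnit_iff_isUnit_det B).mp hB).ne_zero
      have hBdet' : Bᴴ.det ≠ 0 := ((Matrix.isUnit_iff_isUnit_det _).mp hB.star).ne_zero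
      have e : Bᴴ * a s * B + (t : ℂ) • (Bᴴ * g s * B) = Bᴴ * (a s + (t : ℂ) • g s) * B := by
        rw [Matrix.mul_add, Matrix.add_mul, Matrix.mul_smul, Matrix.smul_mul]
      rw [Pi.div_apply, e, det_mul, det_mul, det_mul, det_mul,
        det_add_smul_of_isEigenvalues (hl1 s hs)]
      field_simp
    refine (d3.congr_of_eventuallyEq heq).congr_deriv ?_
    simp only [ha0, hg0, det_one, one_pow, div_one, mul_one, Finset.prod_const_one, one_mul]
    have e0 : (1 + (t : ℂ) • diagonal fun i => (mu i : ℂ)).det = ∏ i, (1 + (mu i : ℂ) * (t : ℂ)) := by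
      rw [← diagonal_one, ← diagonal_smul, diagonal_add, det_diagonal]
      simp [mul_comm]
    rw [e0, Finset.mul_sum, ← Finset.sum_sub_distrib, hq, eval_finsetSum]
    refine Finset.sum_congr rfl fun i _ => ?_
    rw [← Finset.mul_prod_erase Finset.univ _ (Finset.mem_univ i)]
    simp only [linProd, eval_mul, eval_prod, eval_add, eval_one, eval_C, eval_X, Matrix.add_apply,
      Matrix.smul_apply, smul_eq_mul]
    ring
  have hco := hasDerivAt_coeff_linProd (m := k + 1)
    (fun s => (natDegree_linProd_le Finset.univ fun i => (lam s i : ℂ)).trans (by simp)) hqdeg hder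
  have hco' : HasDerivAt (fun s => (f s : ℂ)) (q.coeff (k + 1)) 0 := by
    refine hco.congr_of_eventuallyEq ?_
    filter_upwards [hlam] with s hs
    rw [← hl2 s hs, esymm_eq_coeff]
    have := map_linProd Complex.ofRealHom Finset.univ (lam s)
    simp only [Complex.ofRealHom_eq_coe] at this
    rw [← this, coeff_map]
    rfl
  have huniq := hco'.unique hf.ofReal_comp
  have hre := congrArg Complex.re huniq
  rw [Complex.ofReal_re] at hre
  rw [← hre, hq, finsetSum_coeff, Complex.re_sum]
  refine Finset.sum_congr rfl fun i _ => ?_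
  have hm := map_linProd Complex.ofRealHom (Finset.univ.erase i) mu
  simp only [Complex.ofRealHom_eq_coe] at hm
  rw [coeff_C_mul, coeff_X_mul, ← hm, coeff_map, Complex.ofRealHom_eq_coe, Complex.re_mul_ofReal,
    hg1, ha1, congr_apply_eq_sform, congr_apply_eq_sform, Complex.sub_re, Complex.re_ofReal_mul]
  ring

end Linearization

/-! ### Calculus: complex Hessians and tangential derivatives -/

section Calculus

open Matrix Topology

/-- The Hermitian matrix of the `J`-invariant part of a real bilinear form. -/
def hermPart {n : ℕ} (β : Cn n →L[ℝ] Cn n →L[ℝ] ℝ) : Matrix (Fin n) (Fin n) ℂ :=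
  Matrix.of fun i j =>
    (((β (EuclideanSpace.single i 1) (EuclideanSpace.single j 1) +
      β (EuclideanSpace.single i Complex.I) (EuclideanSpace.single j Complex.I) : ℝ) : ℂ) +
    Complex.I * ((β (EuclideanSpace.single i 1) (EuclideanSpace.single j Complex.I) -
      β (EuclideanSpace.single i Complex.I) (EuclideanSpace.single j 1) : ℝ) : ℂ)) / 4

theorem sum_re_im_single {n : ℕ} (v : Cn n) :
    v = ∑ i, ((v i).re • (EuclideanSpace.single i 1 : Cn n) +
      (v i).im • (EuclideanSpace.single i Complex.I : Cn n)) := by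
  ext k
  simp only [WithLp.ofLp_sum, WithLp.ofLp_add, WithLp.ofLp_smul, Finset.sum_apply, Pi.add_apply,
    Pi.smul_apply, PiLp.single_apply, EuclideanSpace.single]
  rw [Finset.sum_eq_single k (fun i _ hi => by simp [hi.symm]) (by simp)]
  apply Complex.ext <;> simp

theorem bilin_eq_sum {n : ℕ} (β : Cn n →L[ℝ] Cn n →L[ℝ] ℝ) (v w : Cn n) :
    β v w = ∑ i, ∑ j,
      ((v i).re * (w j).re * β (EuclideanSpace.single i 1) (EuclideanSpace.single j 1) +
      (v i).re * (w j).im * β (EuclideanSpace.single i 1) (EuclideanSpace.single j Complex.I) +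
      (v i).im * (w j).re * β (EuclideanSpace.single i Complex.I) (EuclideanSpace.single j 1) +
      (v i).im * (w j).im *
        β (EuclideanSpace.single i Complex.I) (EuclideanSpace.single j Complex.I)) := by
  conv_lhs => rw [sum_re_im_single v, sum_re_im_single w]
  simp only [map_sum, _root_.sum_apply, map_add, map_smul,
    _root_.add_apply, _root_.smul_apply, smul_eq_mul, Finset.mul_sum,
    ← Finset.sum_add_distrib]
  rw [Finset.sum_comm]
  exact Finset.sum_congr rfl fun i _ => Finset.sum_congr rfl fun j _ => by ring

theorem sform_hermPart {n : ℕ} (β : Cn n →L[ℝ] Cn n →L[ℝ] ℝ) (v w : Cn n) :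
    sform (hermPart β) v w =
      (((β v w + β (Complex.I • v) (Complex.I • w) : ℝ) : ℂ) +
        Complex.I * ((β v (Complex.I • w) - β (Complex.I • v) w : ℝ) : ℂ)) / 4 := by
  rw [bilin_eq_sum β v w, bilin_eq_sum β (Complex.I • v) (Complex.I • w),
    bilin_eq_sum β v (Complex.I • w), bilin_eq_sum β (Complex.I • v) w]
  simp only [← Finset.sum_add_distrib, ← Finset.sum_sub_distrib, Complex.ofReal_sum,
    Finset.mul_sum, Finset.sum_div, sform]
  refine Finset.sum_congr rfl fun i _ => Finset.sum_congr rfl fun j _ => ?_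
  simp only [hermPart, Matrix.of_apply, WithLp.ofLp_smul, Pi.smul_apply, smul_eq_mul]
  apply Complex.ext <;> simp <;> ring

theorem re_sform_hermPart {n : ℕ} (β : Cn n →L[ℝ] Cn n →L[ℝ] ℝ) (v w : Cn n) :
    (sform (hermPart β) v w).re = (β v w + β (Complex.I • v) (Complex.I • w)) / 4 := by
  rw [sform_hermPart]; simp

theorem isHermitian_hermPart {n : ℕ} {β : Cn n →L[ℝ] Cn n →L[ℝ] ℝ}
    (hβ : ∀ v w, β v w = β w v) : (hermPart β).IsHermitian := by
  ext i j
  simp only [hermPart, conjTranspose_apply, Matrix.of_apply]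
  rw [hβ (EuclideanSpace.single j 1) (EuclideanSpace.single i 1),
    hβ (EuclideanSpace.single j Complex.I) (EuclideanSpace.single i Complex.I),
    hβ (EuclideanSpace.single j 1) (EuclideanSpace.single i Complex.I),
    hβ (EuclideanSpace.single j Complex.I) (EuclideanSpace.single i 1)]
  apply Complex.ext <;> simp

theorem gMatOn_eq_hermPart {n : ℕ} {s : Set (Cn n)} {χ : Cn n → Matrix (Fin n) (Fin n) ℂ}
    {u : Cn n → ℝ} {z : Cn n} (hs : s ∈ 𝓝 z) (hu : ContDiffAt ℝ 2 u z) :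
    gMatOn s χ u z = χ z + hermPart (fderiv ℝ (fderiv ℝ u) z) := by
  have h1 : ∀ᶠ x in 𝓝 z, ∀ v : Cn n,
      fderivWithin ℝ (fun w => (u w : ℂ)) s x v = (fderiv ℝ u x v : ℂ) := by
    filter_upwards [eventually_mem_nhds_iff.mpr hs, hu.eventually (by simp)] with x hx hux v
    rw [fderivWithin_of_mem_nhds hx]
    have := (Complex.ofRealCLM.hasFDerivAt).comp x
      ((hux.differentiableAt (by simp)).hasFDerivAt)
    rw [HasFDerivAt.fderiv (f := fun w => (u w : ℂ)) this]
    simp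
  have h2 : DifferentiableAt ℝ (fderiv ℝ u) z :=
    (hu.fderiv_right (m := 1) (by norm_num)).differentiableAt (by simp)
  have h3 : ∀ v : Cn n, HasFDerivAt (fun x => ((fderiv ℝ u x v : ℝ) : ℂ))
      (Complex.ofRealCLM.comp ((ContinuousLinearMap.apply ℝ ℝ v).comp
        (fderiv ℝ (fderiv ℝ u) z))) z := fun v =>
    (Complex.ofRealCLM.hasFDerivAt).comp z
      (((ContinuousLinearMap.apply ℝ ℝ v).hasFDerivAt).comp z h2.hasFDerivAt)
  ext i j
  simp only [gMatOn, Matrix.of_apply, Matrix.add_apply, cHessOn]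
  congr 1
  have h4 : wderBarOn s j (fun w => (u w : ℂ)) =ᶠ[𝓝 z] fun x =>
      (((fderiv ℝ u x (EuclideanSpace.single j 1) : ℝ) : ℂ) +
        Complex.I * ((fderiv ℝ u x (EuclideanSpace.single j Complex.I) : ℝ) : ℂ)) / 2 := by
    filter_upwards [h1] with x hx
    simp only [wderBarOn, hx]
  have h5 := ((h3 (EuclideanSpace.single j 1)).add
    ((h3 (EuclideanSpace.single j Complex.I)).const_mul Complex.I)).mul_const (2⁻¹ : ℂ)
  have h6 := h5.congr_of_eventuallyEq (f₁ := wderBarOn s j fun w => (u w : ℂ))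
    (h4.mono fun x hx => hx.trans (div_eq_mul_inv _ _))
  simp only [wderOn, fderivWithin_of_mem_nhds hs, h6.fderiv, hermPart, Matrix.of_apply]
  simp
  linear_combination ((fderiv ℝ (fderiv ℝ u) z (EuclideanSpace.single i Complex.I)
      (EuclideanSpace.single j Complex.I) : ℝ) : ℂ) * (-1 / 4) * Complex.I_mul_I

theorem hasDerivAt_comp_line {E F : Type*} [NormedAddCommGroup E] [NormedSpace ℝ E]
    [NormedAddCommGroup F] [NormedSpace ℝ F] {f : E → F} {z w : E} {s : ℝ}
    (hf : DifferentiableAt ℝ f (z + s • w)) :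
    HasDerivAt (fun r : ℝ => f (z + r • w)) (fderiv ℝ f (z + s • w) w) s := by
  have h1 : HasDerivAt (fun r : ℝ => z + r • w) w s := by
    simpa using ((hasDerivAt_id s).smul_const w).const_add z
  exact hf.hasFDerivAt.comp_hasDerivAt s h1

theorem tendsto_line {E : Type*} [NormedAddCommGroup E] [NormedSpace ℝ E] (z w : E) :
    Filter.Tendsto (fun r : ℝ => z + r • w) (𝓝 0) (𝓝 z) := by
  have : Continuous fun r : ℝ => z + r • w := by fun_prop
  simpa using this.tendsto 0

/-- Second order necessary condition at a local maximum. -/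
theorem second_deriv_nonpos_of_isLocalMax {φ φ' : ℝ → ℝ} {d : ℝ}
    (hφ : ∀ᶠ s in 𝓝 0, HasDerivAt φ (φ' s) s) (hφ' : HasDerivAt φ' d 0)
    (hmax : IsLocalMax φ 0) : d ≤ 0 := by
  by_contra! hd
  have e1 : deriv φ =ᶠ[𝓝 0] φ' := hφ.mono fun s hs => hs.deriv
  have e2 : deriv (deriv φ) 0 = d := by rw [e1.deriv_eq]; exact hφ'.deriv
  have hmin := isLocalMin_of_deriv_deriv_pos (by rw [e2]; exact hd) hmax.deriv_eq_zero
    hφ.self_of_nhds.continuousAt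
  have hconst : φ =ᶠ[𝓝 0] fun _ => φ 0 := by
    filter_upwards [hmin, hmax] with s h1 h2 using le_antisymm h2 h1
  have e3 : deriv φ =ᶠ[𝓝 0] fun _ => (0 : ℝ) := by
    simpa using hconst.deriv
  rw [e3.deriv_eq, deriv_const] at e2
  exact hd.ne e2

/-- First derivative of `z ↦ Du(z)(a (z - c))` in the direction `w`. -/
def rotD {n : ℕ} (u : Cn n → ℝ) (c : Cn n) (a : Cn n →L[ℂ] Cn n) (z w : Cn n) : ℝ :=
  fderiv ℝ (fderiv ℝ u) z w (a (z - c)) + fderiv ℝ u z (a w)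

/-- Second derivative of `z ↦ Du(z)(a (z - c))` in the direction `w`. -/
def rotD2 {n : ℕ} (u : Cn n → ℝ) (c : Cn n) (a : Cn n →L[ℂ] Cn n) (z w : Cn n) : ℝ :=
  fderiv ℝ (fderiv ℝ (fderiv ℝ u)) z w w (a (z - c)) + 2 * fderiv ℝ (fderiv ℝ u) z w (a w)

theorem hasDerivAt_map_line {n : ℕ} (c : Cn n) (a : Cn n →L[ℂ] Cn n) (z w : Cn n) (s : ℝ) :
    HasDerivAt (fun r : ℝ => a (z + r • w - c)) (a w) s := by
  have h1 : HasDerivAt (fun r : ℝ => z + r • w - c) w s := by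
    simpa using (((hasDerivAt_id s).smul_const w).const_add z).sub_const c
  exact ((a.restrictScalars ℝ).hasFDerivAt).comp_hasDerivAt s h1

theorem hasDerivAt_rot {n : ℕ} {u : Cn n → ℝ} (c : Cn n) (a : Cn n →L[ℂ] Cn n) {z w : Cn n}
    {s : ℝ} (hu : ContDiffAt ℝ 2 u (z + s • w)) :
    HasDerivAt (fun r : ℝ => fderiv ℝ u (z + r • w) (a (z + r • w - c)))
      (rotD u c a (z + s • w) w) s := by
  have h2 : DifferentiableAt ℝ (fderiv ℝ u) (z + s • w) :=
    (hu.fderiv_right (m := 1) (by norm_num)).differentiableAt (by simp)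
  exact (hasDerivAt_comp_line h2).clm_apply (hasDerivAt_map_line c a z w s)

theorem hasDerivAt_rotD {n : ℕ} {u : Cn n → ℝ} (c : Cn n) (a : Cn n →L[ℂ] Cn n) {z w : Cn n}
    (hu : ContDiffAt ℝ 3 u z) :
    HasDerivAt (fun r : ℝ => rotD u c a (z + r • w) w) (rotD2 u c a z w) 0 := by
  have hu1 := hu.fderiv_right (m := 2) (by norm_num)
  have hu2 := hu1.fderiv_right (m := 1) (by norm_num)
  have e : z + (0 : ℝ) • w = z := by simp
  have d2 : HasDerivAt (fun r : ℝ => fderiv ℝ (fderiv ℝ u) (z + r • w))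
      (fderiv ℝ (fderiv ℝ (fderiv ℝ u)) z w) 0 := by
    simpa only [e] using hasDerivAt_comp_line (z := z) (w := w) (s := 0)
      (by rw [e]; exact hu2.differentiableAt (by simp))
  have d1 : HasDerivAt (fun r : ℝ => fderiv ℝ u (z + r • w))
      (fderiv ℝ (fderiv ℝ u) z w) 0 := by
    simpa only [e] using hasDerivAt_comp_line (z := z) (w := w) (s := 0)
      (by rw [e]; exact hu1.differentiableAt (by simp))
  have d3 := ((d2.clm_apply (hasDerivAt_const 0 w)).clm_apply (hasDerivAt_map_line c a z w 0)).add
    (d1.clm_apply (hasDerivAt_const 0 (a w)))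
  refine d3.congr_deriv ?_
  simp only [rotD2, e, map_zero, add_zero]
  ring

theorem hasDerivAt_norm_sq_line {n : ℕ} (z w : Cn n) (s : ℝ) :
    HasDerivAt (fun r : ℝ => ‖z + r • w‖ ^ 2) (2 * inner ℝ (z + s • w) w) s := by
  have h1 : HasDerivAt (fun r : ℝ => z + r • w) w s := by
    simpa using ((hasDerivAt_id s).smul_const w).const_add z
  exact h1.norm_sq

theorem hasDerivAt_inner_line {n : ℕ} (z w : Cn n) (s : ℝ) :
    HasDerivAt (fun r : ℝ => 2 * inner ℝ (z + r • w) w) (2 * ‖w‖ ^ 2) s := by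
  have h1 : HasDerivAt (fun r : ℝ => z + r • w) w s := by
    simpa using ((hasDerivAt_id s).smul_const w).const_add z
  have h2 := (h1.inner ℝ (hasDerivAt_const s w)).const_mul 2
  refine h2.congr_deriv ?_
  simp

/-- The maximum condition for the barrier function, in a given direction. -/
theorem barrier_second_deriv_nonpos {n : ℕ} {ι : Type*} [Fintype ι] {u : Cn n → ℝ} {c z : Cn n}
    (a : ι → Cn n →L[ℂ] Cn n) (τ : ι → ℝ) (A B D : ℝ) (hu : ContDiffAt ℝ 3 u z)
    (hmax : IsLocalMax (fun x => ∑ i, (τ i * fderiv ℝ u x (a i (x - c)) +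
      fderiv ℝ u x (a i (x - c)) ^ 2) + A * (‖x - c‖ ^ 2 - D) - B * ‖x‖ ^ 2) z) (w : Cn n) :
    ∑ i, (τ i * rotD2 u c (a i) z w + (2 * fderiv ℝ u z (a i (z - c)) * rotD2 u c (a i) z w +
      2 * rotD u c (a i) z w ^ 2)) + 2 * (A - B) * ‖w‖ ^ 2 ≤ 0 := by
  have e : z + (0 : ℝ) • w = z := by simp
  have hcont : ContinuousAt (fun r : ℝ => z + r • w) 0 := by fun_prop
  have hloc := IsLocalMax.comp_continuous (g := fun r : ℝ => z + r • w) (b := 0)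
    (by rw [e]; exact hmax) hcont
  set φ' : ℝ → ℝ := fun s => ∑ i, (τ i * rotD u c (a i) (z + s • w) w +
      2 * fderiv ℝ u (z + s • w) (a i (z + s • w - c)) * rotD u c (a i) (z + s • w) w) +
      A * (2 * inner ℝ (z - c + s • w) w) - B * (2 * inner ℝ (z + s • w) w) with hφ'
  have key := second_deriv_nonpos_of_isLocalMax (φ' := φ')
    (d := ∑ i, (τ i * rotD2 u c (a i) z w + (2 * rotD u c (a i) z w * rotD u c (a i) z w +
      2 * fderiv ℝ u z (a i (z - c)) * rotD2 u c (a i) z w)) + A * (2 * ‖w‖ ^ 2) -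
      B * (2 * ‖w‖ ^ 2)) ?_ ?_ hloc
  · refine le_trans (le_of_eq ?_) key
    have : ∀ x y z' : ℝ, x + 2 * (A - B) * y = x + A * (2 * y) - B * (2 * y) := fun x y _ => by ring
    rw [this _ _ 0]
    congr 2
    exact Finset.sum_congr rfl fun i _ => by ring
  · have hev : ∀ᶠ s in 𝓝 (0 : ℝ), ContDiffAt ℝ 3 u (z + s • w) :=
      (tendsto_line z w).eventually (hu.eventually (by simp))
    filter_upwards [hev] with s hs
    have hr := fun i => hasDerivAt_rot c (a i) (hs.of_le (m := 2) (by norm_num))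
    have h1 := HasDerivAt.fun_sum (u := Finset.univ) fun i _ =>
      ((hr i).const_mul (τ i)).add ((hr i).pow 2)
    have h2 := (hasDerivAt_norm_sq_line (z - c) w s).sub_const D |>.const_mul A
    have h3 := (hasDerivAt_norm_sq_line z w s).const_mul B
    have h4 := (h1.add h2).sub h3
    refine (h4.congr_deriv ?_).congr_of_eventuallyEq (Filter.Eventually.of_forall fun r => ?_)
    · simp [hφ']
    · simp [show z + r • w - c = z - c + r • w by abel]
  · have hr := fun i => hasDerivAt_rot (s := 0) (w := w) c (a i)
      (by rw [e]; exact hu.of_le (m := 2) (by norm_num))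
    have hrD := fun i => hasDerivAt_rotD (w := w) c (a i) hu
    have h1 := HasDerivAt.fun_sum (u := Finset.univ) fun i _ =>
      ((hrD i).const_mul (τ i)).add (((hr i).const_mul 2).mul (hrD i))
    have h4 := (h1.add ((hasDerivAt_inner_line (z - c) w 0).const_mul A)).sub
      ((hasDerivAt_inner_line z w 0).const_mul B)
    refine h4.congr_deriv ?_
    simp only [e]

end Calculus

/-! ### Infinitesimal unitary rotations -/

section Generators

/-- The standard generators of the unitary group: `v ↦ v_k e_j - v_j e_k` and
`v ↦ i (v_k e_j + v_j e_k)`. -/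
def gen {n : ℕ} : Bool × Fin n × Fin n → Cn n →L[ℂ] Cn n
  | (false, j, k) => (EuclideanSpace.proj k).smulRight (EuclideanSpace.single j (1 : ℂ)) -
      (EuclideanSpace.proj j).smulRight (EuclideanSpace.single k (1 : ℂ))
  | (true, j, k) => Complex.I •
      ((EuclideanSpace.proj k).smulRight (EuclideanSpace.single j (1 : ℂ)) +
        (EuclideanSpace.proj j).smulRight (EuclideanSpace.single k (1 : ℂ)))

theorem gen_false_apply {n : ℕ} (j k : Fin n) (v : Cn n) :
    gen (false, j, k) v = v k • EuclideanSpace.single j (1 : ℂ) -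
      v j • EuclideanSpace.single k (1 : ℂ) := rfl

theorem gen_true_apply {n : ℕ} (j k : Fin n) (v : Cn n) :
    gen (true, j, k) v = Complex.I • (v k • EuclideanSpace.single j (1 : ℂ) +
      v j • EuclideanSpace.single k (1 : ℂ)) := rfl

theorem norm_gen_apply_le {n : ℕ} (τ : Bool × Fin n × Fin n) (v : Cn n) :
    ‖gen τ v‖ ≤ 2 * ‖v‖ := by
  have h : ∀ j k : Fin n, ‖v k • (EuclideanSpace.single j (1 : ℂ) : Cn n)‖ ≤ ‖v‖ := fun j k => by
    rw [norm_smul, PiLp.norm_single, norm_one, mul_one]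
    exact PiLp.norm_apply_le v k
  obtain ⟨_ | _, j, k⟩ := τ
  · rw [gen_false_apply]
    exact (norm_sub_le _ _).trans (by linarith [h j k, h k j])
  · rw [gen_true_apply, norm_smul, Complex.norm_I, one_mul]
    exact (norm_add_le _ _).trans (by linarith [h j k, h k j])

theorem real_inner_gen_self {n : ℕ} (τ : Bool × Fin n × Fin n) (v : Cn n) :
    inner ℝ v (gen τ v) = 0 := by
  have e : inner ℝ v (gen τ v) = (inner ℂ v (gen τ v) : ℂ).re := by
    simp [PiLp.inner_apply, Complex.inner]
  rw [e]
  obtain ⟨_ | _, j, k⟩ := τ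
  · rw [gen_false_apply]
    simp [EuclideanSpace.inner_single_right]
    ring
  · rw [gen_true_apply]
    simp [EuclideanSpace.inner_single_right]
    ring

/-- Vectors orthogonal to `N` are combinations of the rotation fields at `N`. -/
theorem exists_gen_combination {n : ℕ} {N ζ : Cn n} (hN : N ≠ 0) (hζ : inner ℂ ζ N = 0) :
    ∃ q : Bool × Fin n × Fin n → ℝ, (∀ τ, |q τ| ≤ ‖ζ‖ / ‖N‖) ∧ ζ = ∑ τ, q τ • gen τ N := by
  have hN0 : ‖N‖ ≠ 0 := norm_ne_zero_iff.mpr hN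
  set p : Fin n → Fin n → ℂ := fun j k => ζ j * star (N k) / ((‖N‖ ^ 2 : ℝ) : ℂ) with hp
  have hpn : ∀ j k, ‖p j k‖ ≤ ‖ζ‖ / ‖N‖ := fun j k => by
    rw [hp]
    simp only [norm_div, norm_mul, norm_star, Complex.norm_real, norm_pow, norm_norm]
    rw [div_le_div_iff₀ (by positivity) (by positivity)]
    calc ‖ζ j‖ * ‖N k‖ * ‖N‖ ≤ ‖ζ‖ * ‖N‖ * ‖N‖ := by
          gcongr
          · exact PiLp.norm_apply_le ζ j
          · exact PiLp.norm_apply_le N k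
      _ = ‖ζ‖ * ‖N‖ ^ 2 := by ring
  refine ⟨fun τ => if τ.1 then (p τ.2.1 τ.2.2).im else (p τ.2.1 τ.2.2).re, ?_, ?_⟩
  · rintro ⟨_ | _, j, k⟩
    · exact (Complex.abs_re_le_norm _).trans (hpn j k)
    · exact (Complex.abs_im_le_norm _).trans (hpn j k)
  · have hsq : ∑ k, star (N k) * N k = ((‖N‖ ^ 2 : ℝ) : ℂ) := by
      rw [EuclideanSpace.norm_sq_eq]
      push_cast
      exact Finset.sum_congr rfl fun k _ => Complex.conj_mul' _
    have hin : ∑ j, star (ζ j) * N j = 0 := by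
      rw [← hζ, PiLp.inner_apply]
      exact Finset.sum_congr rfl fun j _ => by simp [mul_comm]
    have hterm : ∀ j k, (p j k).re • gen (false, j, k) N + (p j k).im • gen (true, j, k) N =
        (p j k * N k) • (EuclideanSpace.single j (1 : ℂ) : Cn n) -
          (star (p j k) * N j) • (EuclideanSpace.single k (1 : ℂ) : Cn n) := fun j k => by
      rw [gen_false_apply, gen_true_apply]
      have hr : ∀ (r : ℝ) (v : Cn n), r • v = (r : ℂ) • v := fun r v =>
        (Complex.coe_smul r v).symm
      rw [hr, hr]
      have h1 : p j k = (p j k).re + (p j k).im * Complex.I := (Complex.re_add_im _).symm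
      have h2 : star (p j k) = (p j k).re - (p j k).im * Complex.I := by
        apply Complex.ext <;> simp
      rw [h2]
      nth_rewrite 3 [h1]
      module
    rw [Fintype.sum_prod_type, Fintype.sum_bool, Fintype.sum_prod_type, Fintype.sum_prod_type,
      add_comm, ← Finset.sum_add_distrib]
    simp only [← Finset.sum_add_distrib, Bool.false_eq_true, if_true, if_false]
    simp only [hterm, Finset.sum_sub_distrib]
    rw [Finset.sum_comm (f := fun j k => (star (p j k) * N j) •
      (EuclideanSpace.single k (1 : ℂ) : Cn n))]
    simp only [← Finset.sum_smul]
    have h1 : ∀ j, ∑ k, p j k * N k = ζ j := fun j => by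
      have : ∀ k, p j k * N k = ζ j / ((‖N‖ ^ 2 : ℝ) : ℂ) * (star (N k) * N k) := fun k => by
        rw [hp]; ring
      simp only [this, ← Finset.mul_sum, hsq]
      exact div_mul_cancel₀ _ (by exact_mod_cast pow_ne_zero 2 hN0)
    have h2 : ∀ k, ∑ j, star (p j k) * N j = 0 := fun k => by
      have : ∀ j, star (p j k) * N j =
          N k / ((‖N‖ ^ 2 : ℝ) : ℂ) * (star (ζ j) * N j) := fun j => by
        simp [hp]; ring
      simp only [this, ← Finset.mul_sum, hin, mul_zero]
    simp only [h1, h2, zero_smul, Finset.sum_const_zero, sub_zero]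
    ext i
    simp [Finset.sum_apply, Pi.single_apply]

end Generators

/-! ### Pointwise estimates at an interior point -/

section Pointwise

open Topology

theorem sq_add_mul_sum_le {ι : Type*} [Fintype ι] (P Q : ℝ) (x y : ι → ℝ) :
    (P + Q * ∑ τ, (|x τ| + |y τ|)) ^ 2 ≤
      (2 * P ^ 2 + 4 * Q ^ 2 * Fintype.card ι) * (1 + ∑ τ, (x τ ^ 2 + y τ ^ 2)) := by
  set S := ∑ τ, (|x τ| + |y τ|)
  set V := ∑ τ, (x τ ^ 2 + y τ ^ 2) with hV
  have h1 : S ^ 2 ≤ Fintype.card ι * (2 * V) := by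
    refine (sq_sum_le_card_mul_sum_sq (s := Finset.univ)).trans ?_
    rw [Finset.card_univ]
    refine mul_le_mul_of_nonneg_left ?_ (Nat.cast_nonneg _)
    rw [hV, Finset.mul_sum]
    refine Finset.sum_le_sum fun τ _ => ?_
    nlinarith [sq_nonneg (|x τ| - |y τ|), sq_abs (x τ), sq_abs (y τ)]
  have hV0 : 0 ≤ V := Finset.sum_nonneg fun τ _ => by positivity
  have h2 : (P + Q * S) ^ 2 ≤ 2 * P ^ 2 + 2 * (Q ^ 2 * S ^ 2) := by
    nlinarith [sq_nonneg (P - Q * S)]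
  have h3 : Q ^ 2 * S ^ 2 ≤ Q ^ 2 * (Fintype.card ι * (2 * V)) := by gcongr
  have h4 : 0 ≤ P ^ 2 * V := by positivity
  have h5 : 0 ≤ Q ^ 2 * Fintype.card ι := by positivity
  nlinarith

/-- A mixed second derivative in a direction orthogonal to `z - c` is controlled by the
derivatives of the rotation fields. -/
theorem abs_hessian_tangential_le {n : ℕ} {u : Cn n → ℝ} {c z ζ w : Cn n} {Q T : ℝ}
    (hz : z - c ≠ 0) (hζ : inner ℂ ζ (z - c) = 0) (hQ : ‖ζ‖ / ‖z - c‖ ≤ Q)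
    (hT : ∀ τ, |fderiv ℝ u z (gen τ w)| ≤ T) :
    |fderiv ℝ (fderiv ℝ u) z w ζ| ≤
      Q * ∑ τ : Bool × Fin n × Fin n, (|rotD u c (gen τ) z w| + T) := by
  obtain ⟨q, hq, he⟩ := exists_gen_combination hz hζ
  rw [he, map_sum, Finset.mul_sum]
  refine (Finset.abs_sum_le_sum_abs _ _).trans (Finset.sum_le_sum fun τ _ => ?_)
  rw [map_smul, smul_eq_mul, abs_mul]
  have h1 : fderiv ℝ (fderiv ℝ u) z w (gen τ (z - c)) =
      rotD u c (gen τ) z w - fderiv ℝ u z (gen τ w) := by simp [rotD]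
  rw [h1]
  have := hT τ
  gcongr
  · exact (abs_nonneg _).trans ((hq τ).trans hQ)
  · exact (hq τ).trans hQ
  · exact (abs_sub _ _).trans (by linarith)

/-- All eigenvalues but one are controlled by the derivatives of the rotation fields. -/
theorem exists_sq_eigenvalue_le {n : ℕ} (hn : 0 < n) {u : Cn n → ℝ} {c z : Cn n}
    {a χ : Matrix (Fin n) (Fin n) ℂ} {b : Fin n → Cn n} {mu : Fin n → ℝ} {K R M d : ℝ}
    (hframe : IsDiagFrame a (χ + hermPart (fderiv ℝ (fderiv ℝ u) z)) b mu)
    (hsymm : ∀ v w, fderiv ℝ (fderiv ℝ u) z v w = fderiv ℝ (fderiv ℝ u) z w v)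
    (hχ : ∀ i j, ‖χ i j‖ ≤ K) (hb : ∀ i, ‖b i‖ ≤ R) (hM : ‖fderiv ℝ u z‖ ≤ M)
    (hd : 0 < d) (hz : d ≤ ‖z - c‖) :
    ∃ r, ∀ i, i ≠ r → mu i ^ 2 ≤
      (2 * (n ^ 2 * K * (2 * R) * R + 2 * R / d *
          (Fintype.card (Bool × Fin n × Fin n) * (4 * M * R))) ^ 2 +
        4 * (2 * R / d) ^ 2 * Fintype.card (Bool × Fin n × Fin n)) *
      (1 + ∑ τ : Bool × Fin n × Fin n, (rotD u c (gen τ) z (b i) ^ 2 +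
        rotD u c (gen τ) z (Complex.I • b i) ^ 2)) := by
  have : Nonempty (Fin n) := ⟨⟨0, hn⟩⟩
  set N := z - c with hN
  have hN0 : N ≠ 0 := norm_pos_iff.mp (hd.trans_le hz)
  obtain ⟨r, hr⟩ := Finite.exists_max fun i => ‖(inner ℂ N (b i) : ℂ)‖
  have hr0 : (inner ℂ N (b r) : ℂ) ≠ 0 := fun h0 => hN0 <| hframe.span N fun i => by
    have := hr i
    rw [h0, norm_zero] at this
    exact norm_le_zero_iff.mp this
  refine ⟨r, fun i hi => ?_⟩
  have hK : 0 ≤ K := (norm_nonneg _).trans (hχ ⟨0, hn⟩ ⟨0, hn⟩)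
  have hR : 0 ≤ R := (norm_nonneg _).trans (hb i)
  have hM0 : 0 ≤ M := (norm_nonneg _).trans hM
  set q : ℂ := inner ℂ N (b i) / inner ℂ N (b r) with hq
  have hq1 : ‖q‖ ≤ 1 := by
    rw [hq, norm_div]
    exact div_le_one_of_le₀ (hr i) (norm_nonneg _)
  set ζ : Cn n := b i + (-q) • b r with hζ
  have hζN : inner ℂ ζ N = 0 := by
    rw [← inner_conj_symm, hζ, inner_add_right, inner_smul_right, hq]
    simp [div_mul_cancel₀ _ hr0]
  have hIζN : inner ℂ (Complex.I • ζ) N = 0 := by rw [inner_smul_left, hζN, mul_zero]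
  have hζn : ‖ζ‖ ≤ 2 * R := by
    refine (norm_add_le _ _).trans ?_
    rw [norm_smul, norm_neg]
    nlinarith [hb i, hb r, norm_nonneg (b r), norm_nonneg q]
  have hIζn : ‖Complex.I • ζ‖ = ‖ζ‖ := by rw [norm_smul, Complex.norm_I, one_mul]
  have hQ : ‖ζ‖ / ‖N‖ ≤ 2 * R / d := by gcongr
  have hζb : sform a ζ (b i) = 1 := by
    rw [hζ, sform_add_left, sform_smul_left, hframe.orth, hframe.orth]
    simp [hi.symm]
  have hmu : mu i = (sform χ ζ (b i)).re +
      (fderiv ℝ (fderiv ℝ u) z (b i) ζ +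
        fderiv ℝ (fderiv ℝ u) z (Complex.I • b i) (Complex.I • ζ)) / 4 := by
    have h1 := congrArg Complex.re (hframe.diag ζ i)
    rw [hζb, mul_one, Complex.ofReal_re, sform_add, Complex.add_re, re_sform_hermPart,
      hsymm ζ, hsymm (Complex.I • ζ)] at h1
    exact h1.symm
  have hT : ∀ w : Cn n, ‖w‖ ≤ R → ∀ τ, |fderiv ℝ u z (gen τ w)| ≤ 2 * M * R := fun w hw τ => by
    refine ((fderiv ℝ u z).le_opNorm _).trans ?_
    calc ‖fderiv ℝ u z‖ * ‖gen τ w‖ ≤ M * (2 * ‖w‖) := by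
          gcongr
          exact norm_gen_apply_le τ w
      _ ≤ 2 * M * R := by nlinarith
  have hIb : ‖Complex.I • b i‖ ≤ R := by rw [norm_smul, Complex.norm_I, one_mul]; exact hb i
  have h1 := abs_hessian_tangential_le (u := u) hN0 hζN hQ (hT (b i) (hb i))
  have h2 := abs_hessian_tangential_le (u := u) (Q := 2 * R / d) hN0 hIζN (by rw [hIζn]; exact hQ)
    (hT (Complex.I • b i) hIb)
  have h3 : |(sform χ ζ (b i)).re| ≤ n ^ 2 * K * (2 * R) * R := by
    refine (Complex.abs_re_le_norm _).trans ((norm_sform_le hχ _ _).trans ?_)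
    gcongr
    exact hb i
  have hcomb := Finset.sum_add_distrib (s := Finset.univ)
    (f := fun τ : Bool × Fin n × Fin n => |rotD u c (gen τ) z (b i)|)
    (g := fun τ => |rotD u c (gen τ) z (Complex.I • b i)|)
  have hpos : 0 ≤ 2 * R / d * ∑ τ : Bool × Fin n × Fin n, (|rotD u c (gen τ) z (b i)| +
      |rotD u c (gen τ) z (Complex.I • b i)|) :=
    mul_nonneg (by positivity) (Finset.sum_nonneg fun τ _ => by positivity)
  have hpos2 : 0 ≤ 2 * R / d * (Fintype.card (Bool × Fin n × Fin n) * (4 * M * R)) := by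
    positivity
  have hmain : |mu i| ≤ (n ^ 2 * K * (2 * R) * R + 2 * R / d *
      (Fintype.card (Bool × Fin n × Fin n) * (4 * M * R))) + 2 * R / d *
      ∑ τ : Bool × Fin n × Fin n, (|rotD u c (gen τ) z (b i)| +
        |rotD u c (gen τ) z (Complex.I • b i)|) := by
    rw [Finset.sum_add_distrib, Finset.sum_const, Finset.card_univ, nsmul_eq_mul] at h1 h2
    rw [hcomb] at hpos ⊢
    rw [hmu]
    rw [abs_le] at h1 h2 h3 ⊢
    constructor <;> linarith [h1.1, h1.2, h2.1, h2.2, h3.1, h3.2]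
  rw [← sq_abs]
  exact (pow_le_pow_left₀ (abs_nonneg _) hmain 2).trans (sq_add_mul_sum_le _ _ _ _)

end Pointwise

/-! ### The linearized equation along rotation fields -/

section Linearized

open Topology Matrix

theorem fderiv_fderiv_symm {n : ℕ} {u : Cn n → ℝ} {z : Cn n} (hu : ContDiffAt ℝ 2 u z)
    (v w : Cn n) : fderiv ℝ (fderiv ℝ u) z v w = fderiv ℝ (fderiv ℝ u) z w v :=
  (hu.isSymmSndFDerivAt (by simp)).eq v w

theorem third_fderiv_symm {n : ℕ} {u : Cn n → ℝ} {z : Cn n} (hu : ContDiffAt ℝ 3 u z)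
    (w ξ : Cn n) : fderiv ℝ (fderiv ℝ (fderiv ℝ u)) z w w ξ =
      fderiv ℝ (fderiv ℝ (fderiv ℝ u)) z ξ w w := by
  have hu1 := hu.fderiv_right (m := 2) (by norm_num)
  have hu2 := hu1.fderiv_right (m := 1) (by norm_num)
  have hd : ∀ v v' : Cn n, HasFDerivAt (fun x => fderiv ℝ (fderiv ℝ u) x v v')
      (((ContinuousLinearMap.apply ℝ ℝ v').comp (ContinuousLinearMap.apply ℝ _ v)).comp
        (fderiv ℝ (fderiv ℝ (fderiv ℝ u)) z)) z := fun v v' => by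
    have h1 := ((ContinuousLinearMap.apply ℝ (Cn n →L[ℝ] ℝ) v).hasFDerivAt).comp z
      (hu2.differentiableAt (by simp)).hasFDerivAt
    exact ((ContinuousLinearMap.apply ℝ ℝ v').hasFDerivAt).comp z h1
  have hev : (fun x => fderiv ℝ (fderiv ℝ u) x w ξ) =ᶠ[𝓝 z]
      fun x => fderiv ℝ (fderiv ℝ u) x ξ w := by
    filter_upwards [hu.eventually (by simp)] with x hx
    exact fderiv_fderiv_symm (hx.of_le (by norm_num)) w ξ
  have h1 := congrArg (fun L => L w) (((hd w ξ).congr_of_eventuallyEq hev.symm).unique (hd ξ w))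
  have h2 := (hu1.isSymmSndFDerivAt (by simp)).eq w ξ
  have h1' : fderiv ℝ (fderiv ℝ (fderiv ℝ u)) z w w ξ =
    fderiv ℝ (fderiv ℝ (fderiv ℝ u)) z w ξ w := h1
  rw [h1', h2]

theorem hasDerivAt_hermPart {n : ℕ} {β : ℝ → Cn n →L[ℝ] Cn n →L[ℝ] ℝ}
    {β' : Cn n →L[ℝ] Cn n →L[ℝ] ℝ} {s : ℝ} (hβ : HasDerivAt β β' s) (i j : Fin n) :
    HasDerivAt (fun r => hermPart (β r) i j) (hermPart β' i j) s := by
  have h : ∀ v w : Cn n, HasDerivAt (fun r => β r v w) (β' v w) s := fun v w => by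
    simpa using (hβ.clm_apply (hasDerivAt_const s v)).clm_apply (hasDerivAt_const s w)
  exact ((((h _ _).add (h _ _)).ofReal_comp).add
    ((((h _ _).sub (h _ _)).ofReal_comp).const_mul Complex.I)).div_const 4

/-- The linearized operator applied to a rotation derivative of a solution. -/
theorem sum_rotD2_eq {n k : ℕ} {s : Set (Cn n)} {α χ : Cn n → Matrix (Fin n) (Fin n) ℂ}
    {u f : Cn n → ℝ} {c z : Cn n} {B : Matrix (Fin n) (Fin n) ℂ} {mu : Fin n → ℝ}
    (hs : s ∈ 𝓝 z) (hu : ContDiffAt ℝ 3 u z)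
    (hα : ∀ i j, DifferentiableAt ℝ (fun x => α x i j) z)
    (hχ : ∀ i j, DifferentiableAt ℝ (fun x => χ x i j) z) (hf : DifferentiableAt ℝ f z)
    (hdet : ∀ᶠ x in 𝓝 z, (α x).det ≠ 0)
    (hsol : ∀ᶠ x in 𝓝 z, ∃ lam, IsEigenvalues (α x) (gMatOn s χ u x) lam ∧
      esymm (k + 1) lam = f x)
    (hB : IsUnit B) (ha0 : Bᴴ * α z * B = 1)
    (hg0 : Bᴴ * (χ z + hermPart (fderiv ℝ (fderiv ℝ u) z)) * B = diagonal fun i => (mu i : ℂ))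
    (a : Cn n →L[ℂ] Cn n) :
    ∑ i, (linProd (Finset.univ.erase i) mu).coeff k *
        ((rotD2 u c a z (conjCol B i) + rotD2 u c a z (Complex.I • conjCol B i)) / 4) =
      fderiv ℝ f z (a (z - c)) + ∑ i, (linProd (Finset.univ.erase i) mu).coeff k *
        (mu i * (sform (Matrix.of fun p q => fderiv ℝ (fun x => α x p q) z (a (z - c)))
            (conjCol B i) (conjCol B i)).re -
          (sform (Matrix.of fun p q => fderiv ℝ (fun x => χ x p q) z (a (z - c)))
            (conjCol B i) (conjCol B i)).re +
          2 * (mu i * (sform (α z) (a (conjCol B i)) (conjCol B i)).re -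
            (sform (χ z) (a (conjCol B i)) (conjCol B i)).re)) := by
  set ξ := a (z - c) with hξ
  have e : z + (0 : ℝ) • ξ = z := by simp
  have hu1 := hu.fderiv_right (m := 2) (by norm_num)
  have hu2 := hu1.fderiv_right (m := 1) (by norm_num)
  have hline : ∀ {F : Type} [NormedAddCommGroup F] [NormedSpace ℝ F] {φ : Cn n → F},
      DifferentiableAt ℝ φ z → HasDerivAt (fun r : ℝ => φ (z + r • ξ)) (fderiv ℝ φ z ξ) 0 := by
    intro F _ _ φ hφ
    simpa only [e] using hasDerivAt_comp_line (z := z) (w := ξ) (s := 0) (by rw [e]; exact hφ)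
  have hgcurve : ∀ i j, HasDerivAt (fun r : ℝ => gMatOn s χ u (z + r • ξ) i j)
      ((Matrix.of (fun p q => fderiv ℝ (fun x => χ x p q) z ξ) +
        hermPart (fderiv ℝ (fderiv ℝ (fderiv ℝ u)) z ξ)) i j) 0 := fun i j => by
    have h1 := (hline (hχ i j)).add
      (hasDerivAt_hermPart (hline (hu2.differentiableAt (by simp))) i j)
    refine h1.congr_of_eventuallyEq ?_
    have hev : ∀ᶠ x in 𝓝 z,
        gMatOn s χ u x i j = χ x i j + hermPart (fderiv ℝ (fderiv ℝ u) x) i j := by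
      filter_upwards [eventually_mem_nhds_iff.mpr hs, hu.eventually (by simp)] with x hx hux
      rw [gMatOn_eq_hermPart hx (hux.of_le (by norm_num))]
      rfl
    exact (tendsto_line z ξ).eventually hev
  have hlin := hasDerivAt_esymm_eigenvalues (k := k) (B := B) (mu := mu)
    (a := fun r => α (z + r • ξ)) (g := fun r => gMatOn s χ u (z + r • ξ))
    (a' := Matrix.of fun p q => fderiv ℝ (fun x => α x p q) z ξ)
    (fun i j => hline (hα i j)) hgcurve ((tendsto_line z ξ).eventually hdet) hB
    (by simpa only [e] using ha0)
    (by simp only [e]; rw [gMatOn_eq_hermPart hs (hu.of_le (by norm_num))]; exact hg0)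
    ((tendsto_line z ξ).eventually hsol) (hline hf)
  have hframe := isDiagFrame_conjCol hB ha0 hg0
  rw [hlin, ← Finset.sum_add_distrib]
  refine Finset.sum_congr rfl fun i _ => ?_
  set b := conjCol B i with hb
  have h1 : (sform (hermPart (fderiv ℝ (fderiv ℝ u) z)) (a b) b).re =
      mu i * (sform (α z) (a b) b).re - (sform (χ z) (a b) b).re := by
    have := congrArg Complex.re (hframe.diag (a b) i)
    rw [sform_add, Complex.add_re, Complex.re_ofReal_mul] at this
    linarith
  rw [sform_add, Complex.add_re, re_sform_hermPart, ← h1, re_sform_hermPart]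
  simp only [rotD2, ← hξ, map_smul a,
    fderiv_fderiv_symm (hu.of_le (m := 2) (by norm_num)) (a b),
    fderiv_fderiv_symm (hu.of_le (m := 2) (by norm_num)) (Complex.I • a b)]
  rw [third_fderiv_symm hu b ξ, third_fderiv_symm hu (Complex.I • b) ξ]
  ring

theorem abs_sum_rotD2_le {n k : ℕ} {s : Set (Cn n)} {α χ : Cn n → Matrix (Fin n) (Fin n) ℂ}
    {u f : Cn n → ℝ} {c z : Cn n} {B : Matrix (Fin n) (Fin n) ℂ} {mu : Fin n → ℝ} {K R d : ℝ}
    (hs : s ∈ 𝓝 z) (hu : ContDiffAt ℝ 3 u z)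
    (hα : ∀ i j, DifferentiableAt ℝ (fun x => α x i j) z)
    (hχ : ∀ i j, DifferentiableAt ℝ (fun x => χ x i j) z) (hf : DifferentiableAt ℝ f z)
    (hdet : ∀ᶠ x in 𝓝 z, (α x).det ≠ 0)
    (hsol : ∀ᶠ x in 𝓝 z, ∃ lam, IsEigenvalues (α x) (gMatOn s χ u x) lam ∧
      esymm (k + 1) lam = f x)
    (hB : IsUnit B) (ha0 : Bᴴ * α z * B = 1)
    (hg0 : Bᴴ * (χ z + hermPart (fderiv ℝ (fderiv ℝ u) z)) * B = diagonal fun i => (mu i : ℂ))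
    (hσ : ∀ i, 0 ≤ (linProd (Finset.univ.erase i) mu).coeff k)
    (hK : 0 ≤ K) (hR : 0 ≤ R) (hd : ‖z - c‖ ≤ d) (hb : ∀ i, ‖conjCol B i‖ ≤ R)
    (hαK : ∀ i j, ‖α z i j‖ ≤ K) (hχK : ∀ i j, ‖χ z i j‖ ≤ K)
    (hαK' : ∀ i j, ‖fderiv ℝ (fun x => α x i j) z‖ ≤ K)
    (hχK' : ∀ i j, ‖fderiv ℝ (fun x => χ x i j) z‖ ≤ K) (hfK : ‖fderiv ℝ f z‖ ≤ K)
    {a : Cn n →L[ℂ] Cn n} (ha : ∀ v, ‖a v‖ ≤ 2 * ‖v‖) :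
    |∑ i, (linProd (Finset.univ.erase i) mu).coeff k *
        ((rotD2 u c a z (conjCol B i) + rotD2 u c a z (Complex.I • conjCol B i)) / 4)| ≤
      (K * (2 * d) + n ^ 2 * (K * (2 * d)) * R * R + 2 * (n ^ 2 * K * (2 * R) * R)) *
        (1 + ∑ i, (linProd (Finset.univ.erase i) mu).coeff k +
          ∑ i, (linProd (Finset.univ.erase i) mu).coeff k * |mu i|) := by
  rw [sum_rotD2_eq hs hu hα hχ hf hdet hsol hB ha0 hg0]
  have hd0 : 0 ≤ d := (norm_nonneg _).trans hd
  have hξ : ‖a (z - c)‖ ≤ 2 * d := (ha _).trans (by linarith)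
  set ξ := a (z - c)
  set P := n ^ 2 * (K * (2 * d)) * R * R + 2 * (n ^ 2 * K * (2 * R) * R) with hP
  have hP0 : 0 ≤ P := by positivity
  have h0 : |fderiv ℝ f z ξ| ≤ K * (2 * d) :=
    ((fderiv ℝ f z).le_opNorm _).trans (by gcongr)
  have hform : ∀ (M : Matrix (Fin n) (Fin n) ℂ) (L T : ℝ) (v w : Cn n), (∀ i j, ‖M i j‖ ≤ L) →
      ‖v‖ ≤ T → ‖w‖ ≤ R → 0 ≤ L → 0 ≤ T → |(sform M v w).re| ≤ n ^ 2 * L * T * R := by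
    intro M L T v w hM hv hw hL hT
    refine (Complex.abs_re_le_norm _).trans ((norm_sform_le hM _ _).trans ?_)
    gcongr
  have hterm : ∀ i, |mu i * (sform (Matrix.of fun p q => fderiv ℝ (fun x => α x p q) z ξ)
            (conjCol B i) (conjCol B i)).re -
          (sform (Matrix.of fun p q => fderiv ℝ (fun x => χ x p q) z ξ)
            (conjCol B i) (conjCol B i)).re +
          2 * (mu i * (sform (α z) (a (conjCol B i)) (conjCol B i)).re -
            (sform (χ z) (a (conjCol B i)) (conjCol B i)).re)| ≤ P * (1 + |mu i|) := by
    intro i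
    have hab : ‖a (conjCol B i)‖ ≤ 2 * R := (ha _).trans (by linarith [hb i])
    have t1 := hform (Matrix.of fun p q => fderiv ℝ (fun x => α x p q) z ξ) (K * (2 * d)) R
      (conjCol B i) (conjCol B i)
      (fun p q => ((fderiv ℝ (fun x => α x p q) z).le_opNorm _).trans
        (mul_le_mul (hαK' p q) hξ (norm_nonneg _) hK)) (hb i) (hb i) (by positivity) hR
    have t2 := hform (Matrix.of fun p q => fderiv ℝ (fun x => χ x p q) z ξ) (K * (2 * d)) R
      (conjCol B i) (conjCol B i)
      (fun p q => ((fderiv ℝ (fun x => χ x p q) z).le_opNorm _).trans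
        (mul_le_mul (hχK' p q) hξ (norm_nonneg _) hK)) (hb i) (hb i) (by positivity) hR
    have t3 := hform (α z) K (2 * R) _ _ hαK hab (hb i) hK (by positivity)
    have t4 := hform (χ z) K (2 * R) _ _ hχK hab (hb i) hK (by positivity)
    refine (abs_add_le _ _).trans ?_
    rw [abs_mul 2, abs_two]
    have s1 := abs_sub (mu i * (sform (Matrix.of fun p q => fderiv ℝ (fun x => α x p q) z ξ)
            (conjCol B i) (conjCol B i)).re)
          (sform (Matrix.of fun p q => fderiv ℝ (fun x => χ x p q) z ξ)
            (conjCol B i) (conjCol B i)).re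
    have s2 := abs_sub (mu i * (sform (α z) (a (conjCol B i)) (conjCol B i)).re)
            (sform (χ z) (a (conjCol B i)) (conjCol B i)).re
    rw [abs_mul] at s1 s2
    have r1 := mul_le_mul_of_nonneg_left t1 (abs_nonneg (mu i))
    have r2 := mul_le_mul_of_nonneg_left t3 (abs_nonneg (mu i))
    rw [hP]
    linarith
  refine (abs_add_le _ _).trans ?_
  have hsum := Finset.abs_sum_le_sum_abs (fun i => (linProd (Finset.univ.erase i) mu).coeff k *
        (mu i * (sform (Matrix.of fun p q => fderiv ℝ (fun x => α x p q) z ξ)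
            (conjCol B i) (conjCol B i)).re -
          (sform (Matrix.of fun p q => fderiv ℝ (fun x => χ x p q) z ξ)
            (conjCol B i) (conjCol B i)).re +
          2 * (mu i * (sform (α z) (a (conjCol B i)) (conjCol B i)).re -
            (sform (χ z) (a (conjCol B i)) (conjCol B i)).re))) Finset.univ
  have hsum2 : ∑ i, |(linProd (Finset.univ.erase i) mu).coeff k *
        (mu i * (sform (Matrix.of fun p q => fderiv ℝ (fun x => α x p q) z ξ)
            (conjCol B i) (conjCol B i)).re -
          (sform (Matrix.of fun p q => fderiv ℝ (fun x => χ x p q) z ξ)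
            (conjCol B i) (conjCol B i)).re +
          2 * (mu i * (sform (α z) (a (conjCol B i)) (conjCol B i)).re -
            (sform (χ z) (a (conjCol B i)) (conjCol B i)).re))| ≤
      P * (∑ i, (linProd (Finset.univ.erase i) mu).coeff k +
          ∑ i, (linProd (Finset.univ.erase i) mu).coeff k * |mu i|) := by
    rw [← Finset.sum_add_distrib, Finset.mul_sum]
    refine Finset.sum_le_sum fun i _ => ?_
    rw [abs_mul, abs_of_nonneg (hσ i)]
    refine (mul_le_mul_of_nonneg_left (hterm i) (hσ i)).trans (le_of_eq (by ring))
  have hS : 0 ≤ ∑ i, (linProd (Finset.univ.erase i) mu).coeff k :=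
    Finset.sum_nonneg fun i _ => hσ i
  have hE : 0 ≤ ∑ i, (linProd (Finset.univ.erase i) mu).coeff k * |mu i| :=
    Finset.sum_nonneg fun i _ => mul_nonneg (hσ i) (abs_nonneg _)
  have hKd : 0 ≤ K * (2 * d) := by positivity
  nlinarith

end Linearized

/-! ### The barrier has no interior maximum -/

section Barrier

open Topology Matrix

theorem barrier_sum_pos {n : ℕ} {σ mu X : Fin n → ℝ} {r : Fin n} {G Q C₂ C₃ κ : ℝ}
    (hσ : ∀ i, 0 ≤ σ i) (hX : ∀ i, 0 ≤ X i) (hC₂ : 0 < C₂)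
    (hmu : ∀ i, i ≠ r → mu i ^ 2 ≤ C₂ * (1 + X i)) (hQ : 0 ≤ Q) (hC₃ : 0 ≤ C₃) (hκ : 0 < κ)
    (hS : κ ≤ ∑ i, σ i) (hsum : |∑ i, mu i * σ i| ≤ C₃)
    (hG : |G| ≤ Q * (1 + ∑ i, σ i + ∑ i, σ i * |mu i|)) :
    0 < G + 1 / 2 * ∑ i, σ i * X i +
      (Q * (1 + C₃) / κ + Q + 1 / 2 + 2 * Q ^ 2 * C₂ + 1) * ∑ i, σ i := by
  set S := ∑ i, σ i with hSdef
  set Y := ∑ i, σ i * X i with hYdef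
  set F := ∑ i ∈ Finset.univ.erase r, σ i * |mu i| with hF
  have hS0 : 0 < S := hκ.trans_le hS
  have hE : ∑ i, σ i * |mu i| = σ r * |mu r| + F :=
    (Finset.add_sum_erase _ _ (Finset.mem_univ r)).symm
  have hr : σ r * |mu r| ≤ C₃ + F := by
    have h1 := (Finset.add_sum_erase Finset.univ (fun i => mu i * σ i) (Finset.mem_univ r)).symm
    have h2 : |∑ i ∈ Finset.univ.erase r, mu i * σ i| ≤ F := by
      refine (Finset.abs_sum_le_sum_abs _ _).trans (le_of_eq ?_)
      refine Finset.sum_congr rfl fun i _ => ?_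
      rw [abs_mul, abs_of_nonneg (hσ i), mul_comm]
    have h3 : σ r * |mu r| = |mu r * σ r| := by rw [abs_mul, abs_of_nonneg (hσ r), mul_comm]
    rw [h3, show mu r * σ r = ∑ i, mu i * σ i - ∑ i ∈ Finset.univ.erase r, mu i * σ i by
      rw [h1]; ring]
    exact (abs_sub _ _).trans (add_le_add hsum h2)
  have hF2 : 2 * Q * F ≤ (1 / 2 + 2 * Q ^ 2 * C₂) * S + 1 / 2 * Y := by
    have h1 : (1 / 2 + 2 * Q ^ 2 * C₂) * S + 1 / 2 * Y =
        ∑ i, σ i * (1 / 2 * (1 + X i) + 2 * Q ^ 2 * C₂) := by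
      rw [hSdef, hYdef, Finset.mul_sum, Finset.mul_sum, ← Finset.sum_add_distrib]
      exact Finset.sum_congr rfl fun i _ => by ring
    rw [h1, hF, Finset.mul_sum]
    refine (Finset.sum_le_sum fun i hi => ?_).trans
      (Finset.sum_le_sum_of_subset_of_nonneg (Finset.erase_subset r _) fun i _ _ => ?_)
    · have h2 := hmu i (Finset.ne_of_mem_erase hi)
      have h3 : 2 * Q * |mu i| ≤ 1 / 2 * (1 + X i) + 2 * Q ^ 2 * C₂ := by
        refine le_of_mul_le_mul_left ?_ hC₂
        nlinarith [sq_nonneg (|mu i| - 2 * Q * C₂), sq_abs (mu i)]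
      calc 2 * Q * (σ i * |mu i|) = σ i * (2 * Q * |mu i|) := by ring
        _ ≤ _ := mul_le_mul_of_nonneg_left h3 (hσ i)
    · have := hX i
      exact mul_nonneg (hσ i) (by positivity)
  have h1 : Q * (1 + C₃) ≤ Q * (1 + C₃) / κ * S := by
    rw [div_mul_eq_mul_div, le_div_iff₀ hκ]
    exact mul_le_mul_of_nonneg_left hS (by positivity)
  have h2 := neg_le_of_abs_le hG
  have h3 : Q * (1 + S + ∑ i, σ i * |mu i|) ≤ Q * (1 + S + (C₃ + 2 * F)) := by
    rw [hE]
    exact mul_le_mul_of_nonneg_left (by linarith) hQ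
  nlinarith

theorem frame_norm_bounds {n : ℕ} {a g : Matrix (Fin n) (Fin n) ℂ} {b : Fin n → Cn n}
    {mu : Fin n → ℝ} {K c₀ : ℝ} (hK : 0 < K) (hc₀ : 0 < c₀) (hframe : IsDiagFrame a g b mu)
    (ha : ∀ i j, ‖a i j‖ ≤ K) (hpos : ∀ v : Cn n, c₀ * ‖v‖ ^ 2 ≤ (sform a v v).re)
    (i : Fin n) : ‖b i‖ ≤ √(1 / c₀) ∧ 1 / (n ^ 2 * K) ≤ ‖b i‖ ^ 2 := by
  have hn : 0 < n := i.pos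
  have h1 : sform a (b i) (b i) = 1 := by simp [hframe.orth]
  constructor
  · refine Real.le_sqrt_of_sq_le ?_
    rw [le_div_iff₀ hc₀, mul_comm]
    simpa [h1] using hpos (b i)
  · rw [div_le_iff₀ (by positivity)]
    have := norm_sform_le ha (b i) (b i)
    rw [h1, norm_one] at this
    linarith

set_option maxHeartbeats 1000000 in
/-- For `A - B` large enough, the barrier function has no local maximum at a point away from
the centre of the ball. -/
theorem exists_barrier_constant (n k : ℕ) (hkn : k + 1 ≤ n) {K c₀ d d₀ M κ C₃ : ℝ} (hK : 0 < K)
    (hc₀ : 0 < c₀) (hd₀ : 0 < d₀) (hκ : 0 < κ) (hκ1 : κ ≤ 1) (hC₃ : 0 ≤ C₃) :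
    ∃ D : ℝ, 0 ≤ D ∧ ∀ (A B' D' : ℝ) (t : Bool × Fin n × Fin n → ℝ) (s : Set (Cn n))
      (α χ : Cn n → Matrix (Fin n) (Fin n) ℂ) (u f : Cn n → ℝ) (c z : Cn n),
      D ≤ A - B' → (∀ τ, |t τ| ≤ 1) → s ∈ 𝓝 z → ContDiffAt ℝ 3 u z →
      (∀ i j, DifferentiableAt ℝ (fun x => α x i j) z) →
      (∀ i j, DifferentiableAt ℝ (fun x => χ x i j) z) → DifferentiableAt ℝ f z →
      (∀ᶠ x in 𝓝 z, (α x).PosDef) → (χ z).IsHermitian →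
      (∀ᶠ x in 𝓝 z, ∃ lam, IsEigenvalues (α x) (gMatOn s χ u x) lam ∧ lam ∈ GammaCone n (k + 1) ∧
        esymm (k + 1) lam = f x) →
      (∀ i j, ‖α z i j‖ ≤ K) → (∀ i j, ‖χ z i j‖ ≤ K) →
      (∀ i j, ‖fderiv ℝ (fun x => α x i j) z‖ ≤ K) →
      (∀ i j, ‖fderiv ℝ (fun x => χ x i j) z‖ ≤ K) → ‖fderiv ℝ f z‖ ≤ K →
      (∀ v : Cn n, c₀ * ‖v‖ ^ 2 ≤ (sform (α z) v v).re) → ‖fderiv ℝ u z‖ ≤ M →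
      κ ≤ f z → (k + 1) * f z ≤ C₃ → d₀ ≤ ‖z - c‖ → ‖z - c‖ ≤ d →
      ¬ IsLocalMax (fun x => ∑ τ : Bool × Fin n × Fin n, (t τ * fderiv ℝ u x (gen τ (x - c)) +
        fderiv ℝ u x (gen τ (x - c)) ^ 2) + A * (‖x - c‖ ^ 2 - D') - B' * ‖x‖ ^ 2) z := by
  have hn : 0 < n := by omega
  set R := √(1 / c₀) with hR
  have hR0 : 0 < R := Real.sqrt_pos.mpr (by positivity)
  set C₂ := (2 * (n ^ 2 * K * (2 * R) * R + 2 * R / d₀ *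
          (Fintype.card (Bool × Fin n × Fin n) * (4 * M * R))) ^ 2 +
        4 * (2 * R / d₀) ^ 2 * Fintype.card (Bool × Fin n × Fin n)) with hC₂def
  have : Nonempty (Fin n) := ⟨⟨0, hn⟩⟩
  have hC₂ : 0 < C₂ := by
    have : 0 < (Fintype.card (Bool × Fin n × Fin n) : ℝ) := by exact_mod_cast Fintype.card_pos
    positivity
  set C₁ := (K * (2 * d) + n ^ 2 * (K * (2 * d)) * R * R + 2 * (n ^ 2 * K * (2 * R) * R)) with hC₁
  set Q := Fintype.card (Bool × Fin n × Fin n) * ((1 + 2 * (M * (2 * d))) * C₁) with hQdef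
  set E := Q * (1 + C₃) / κ + Q + 1 / 2 + 2 * Q ^ 2 * C₂ + 1 with hE
  refine ⟨|E| * (n ^ 2 * K), by positivity, ?_⟩
  intro A B' D' t s α χ u f c z hAB ht hs hu hα hχ hf hpd hχh hsol hαK hχK hαK' hχK' hfK hpos hM
    hκf hf3 hz0 hz hmax
  have hd : 0 ≤ d := (norm_nonneg _).trans hz
  have hM0 : 0 ≤ M := (norm_nonneg _).trans hM
  have hC₁0 : 0 ≤ C₁ := by positivity
  have hQ0 : 0 ≤ Q := by positivity
  have hE0 : 0 ≤ E := by positivity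
  rw [abs_of_nonneg hE0] at hAB
  have hsymm := fderiv_fderiv_symm (hu.of_le (m := 2) (by norm_num))
  obtain ⟨B, mu, hB, ha0, hg0⟩ := exists_congr_diagonal hpd.self_of_nhds
    (hχh.add (isHermitian_hermPart hsymm))
  have hframe := isDiagFrame_conjCol hB ha0 hg0
  have hbn := frame_norm_bounds hK hc₀ hframe hαK hpos
  obtain ⟨lam, hlam, hcone, hlamf⟩ := hsol.self_of_nhds
  rw [gMatOn_eq_hermPart hs (hu.of_le (by norm_num))] at hlam
  have hlp := linProd_eq_of_isEigenvalues hlam ha0 hg0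
  have hcoef : ∀ l, 1 ≤ l → l ≤ k + 1 → 0 < (linProd Finset.univ mu).coeff l := fun l h1 h2 => by
    rw [hlp, ← esymm_eq_coeff]
    exact hcone l h1 h2
  have hcf : (linProd Finset.univ mu).coeff (k + 1) = f z := by
    rw [hlp, ← esymm_eq_coeff, hlamf]
  set σ : Fin n → ℝ := fun i => (linProd (Finset.univ.erase i) mu).coeff k with hσdef
  have hσ : ∀ i, 0 ≤ σ i := fun i =>
    (linProd_erase_coeff_pos hcoef (Finset.mem_univ i) k (by omega)).le
  have hS : κ ≤ ∑ i, σ i := by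
    rw [hσdef, sum_linProd_erase_coeff]
    have h1 := min_one_le_linProd_coeff hcoef
    rw [hcf] at h1
    have h2 : κ ≤ (linProd Finset.univ mu).coeff k := (le_min hκ1 hκf).trans h1
    have h3 : (1 : ℝ) ≤ (Finset.univ : Finset (Fin n)).card - k := by
      rw [Finset.card_univ, Fintype.card_fin]
      have : ((k + 1 : ℕ) : ℝ) ≤ n := by exact_mod_cast hkn
      push_cast at this
      linarith
    exact h2.trans (le_mul_of_one_le_left (hκ.le.trans h2) h3)
  have hsum : |∑ i, mu i * σ i| ≤ C₃ := by
    rw [hσdef, sum_mul_linProd_erase_coeff, hcf, abs_of_nonneg]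
    · exact hf3
    · have : 0 ≤ f z := hκ.le.trans hκf
      positivity
  obtain ⟨r, hr⟩ := exists_sq_eigenvalue_le hn hframe hsymm hχK (fun i => (hbn i).1) hM hd₀ hz0
  set X : Fin n → ℝ := fun i => ∑ τ : Bool × Fin n × Fin n,
    (rotD u c (gen τ) z (conjCol B i) ^ 2 +
      rotD u c (gen τ) z (Complex.I • conjCol B i) ^ 2) with hXdef
  have hX : ∀ i, 0 ≤ X i := fun i => Finset.sum_nonneg fun τ _ => by positivity
  set L : Bool × Fin n × Fin n → ℝ := fun τ => ∑ i, σ i *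
    ((rotD2 u c (gen τ) z (conjCol B i) + rotD2 u c (gen τ) z (Complex.I • conjCol B i)) / 4)
    with hLdef
  have hL : ∀ τ, |L τ| ≤ C₁ * (1 + ∑ i, σ i + ∑ i, σ i * |mu i|) := fun τ =>
    abs_sum_rotD2_le hs hu hα hχ hf (hpd.mono fun x hx => hx.det_pos.ne')
      (hsol.mono fun x ⟨l, h1, _, h3⟩ => ⟨l, h1, h3⟩) hB ha0 hg0 hσ hK.le hR0.le hz
      (fun i => (hbn i).1) hαK hχK hαK' hχK' hfK (norm_gen_apply_le τ)
  set v : Bool × Fin n × Fin n → ℝ := fun τ => fderiv ℝ u z (gen τ (z - c)) with hv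
  have hvM : ∀ τ, |v τ| ≤ M * (2 * d) := fun τ => by
    refine ((fderiv ℝ u z).le_opNorm _).trans ?_
    have h1 : ‖gen τ (z - c)‖ ≤ 2 * d := (norm_gen_apply_le τ _).trans (by linarith)
    gcongr
  set G := ∑ τ, (t τ + 2 * v τ) * L τ with hG
  have hGbound : |G| ≤ Q * (1 + ∑ i, σ i + ∑ i, σ i * |mu i|) := by
    have h1 : ∀ τ, |(t τ + 2 * v τ) * L τ| ≤
        (1 + 2 * (M * (2 * d))) * (C₁ * (1 + ∑ i, σ i + ∑ i, σ i * |mu i|)) := fun τ => by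
      rw [abs_mul]
      refine mul_le_mul ?_ (hL τ) (abs_nonneg _) (by positivity)
      refine (abs_add_le _ _).trans ?_
      rw [abs_mul, abs_two]
      linarith [ht τ, hvM τ]
    refine (Finset.abs_sum_le_sum_abs _ _).trans ((Finset.sum_le_sum fun τ _ => h1 τ).trans ?_)
    rw [Finset.sum_const, Finset.card_univ, nsmul_eq_mul, hQdef]
    exact le_of_eq (by ring)
  have hbar : 0 < G + 1 / 2 * ∑ i, σ i * X i + E * ∑ i, σ i :=
    barrier_sum_pos hσ hX hC₂ hr hQ0 hC₃ hκ hS hsum hGbound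
  have hmaxw := fun w => barrier_second_deriv_nonpos gen t A B' D' hu hmax w
  have hneg : G + 1 / 2 * ∑ i, σ i * X i + (A - B') * ∑ i, σ i * ‖conjCol B i‖ ^ 2 ≤ 0 := by
    have h1 : G + 1 / 2 * ∑ i, σ i * X i + (A - B') * ∑ i, σ i * ‖conjCol B i‖ ^ 2 =
        ∑ i, σ i / 4 * ((∑ τ, (t τ * rotD2 u c (gen τ) z (conjCol B i) +
            (2 * fderiv ℝ u z (gen τ (z - c)) * rotD2 u c (gen τ) z (conjCol B i) +
              2 * rotD u c (gen τ) z (conjCol B i) ^ 2)) +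
              2 * (A - B') * ‖conjCol B i‖ ^ 2) +
          (∑ τ, (t τ * rotD2 u c (gen τ) z (Complex.I • conjCol B i) +
            (2 * fderiv ℝ u z (gen τ (z - c)) * rotD2 u c (gen τ) z (Complex.I • conjCol B i) +
              2 * rotD u c (gen τ) z (Complex.I • conjCol B i) ^ 2)) +
              2 * (A - B') * ‖Complex.I • conjCol B i‖ ^ 2)) := by
      have hGi : G = ∑ i, σ i / 4 * ∑ τ, (t τ + 2 * v τ) *
          (rotD2 u c (gen τ) z (conjCol B i) +
            rotD2 u c (gen τ) z (Complex.I • conjCol B i)) := by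
        simp only [hG, hLdef, Finset.mul_sum]
        rw [Finset.sum_comm]
        exact Finset.sum_congr rfl fun i _ => Finset.sum_congr rfl fun τ _ => by ring
      rw [hGi, Finset.mul_sum, Finset.mul_sum, ← Finset.sum_add_distrib,
        ← Finset.sum_add_distrib]
      refine Finset.sum_congr rfl fun i _ => ?_
      rw [norm_smul, Complex.norm_I, one_mul]
      have h2 : ∑ τ, (t τ * rotD2 u c (gen τ) z (conjCol B i) +
            (2 * fderiv ℝ u z (gen τ (z - c)) * rotD2 u c (gen τ) z (conjCol B i) +
              2 * rotD u c (gen τ) z (conjCol B i) ^ 2)) +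
          ∑ τ, (t τ * rotD2 u c (gen τ) z (Complex.I • conjCol B i) +
            (2 * fderiv ℝ u z (gen τ (z - c)) * rotD2 u c (gen τ) z (Complex.I • conjCol B i) +
              2 * rotD u c (gen τ) z (Complex.I • conjCol B i) ^ 2)) =
          (∑ τ, (t τ + 2 * v τ) * (rotD2 u c (gen τ) z (conjCol B i) +
            rotD2 u c (gen τ) z (Complex.I • conjCol B i))) + 2 * X i := by
        rw [hXdef, Finset.mul_sum, ← Finset.sum_add_distrib, ← Finset.sum_add_distrib]
        exact Finset.sum_congr rfl fun τ _ => by simp only [hv]; ring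
      linear_combination (-(σ i / 4)) * h2
    rw [h1]
    refine Finset.sum_nonpos fun i _ => mul_nonpos_of_nonneg_of_nonpos ?_ ?_
    · have := hσ i
      positivity
    · exact add_nonpos (hmaxw _) (hmaxw _)
  have hSb : E * ∑ i, σ i ≤ (A - B') * ∑ i, σ i * ‖conjCol B i‖ ^ 2 := by
    rw [Finset.mul_sum, Finset.mul_sum]
    refine Finset.sum_le_sum fun i _ => ?_
    have h1 := (hbn i).2
    rw [div_le_iff₀ (by positivity)] at h1
    have h2 : E ≤ (A - B') * ‖conjCol B i‖ ^ 2 := by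
      calc E ≤ E * (‖conjCol B i‖ ^ 2 * (n ^ 2 * K)) := le_mul_of_one_le_right hE0 h1
        _ = E * (n ^ 2 * K) * ‖conjCol B i‖ ^ 2 := by ring
        _ ≤ _ := by gcongr
    calc E * σ i ≤ (A - B') * ‖conjCol B i‖ ^ 2 * σ i := mul_le_mul_of_nonneg_right h2 (hσ i)
      _ = _ := by ring
  exact absurd (hbar.trans_le (add_le_add le_rfl hSb)) hneg.not_gt

end Barrier

/-! ### Uniform bounds on the closed ball -/

section Compactness

open Topology Matrix

theorem uniqueDiffOn_closedBall {n : ℕ} (c : Cn n) {δ : ℝ} (hδ : 0 < δ) :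
    UniqueDiffOn ℝ (closedBall c δ) :=
  uniqueDiffOn_convex (convex_closedBall c δ)
    ⟨c, ball_subset_interior_closedBall (mem_ball_self hδ)⟩

theorem closedBall_mem_nhds_of_mem_ball {n : ℕ} {c z : Cn n} {δ : ℝ} (hz : z ∈ ball c δ) :
    closedBall c δ ∈ 𝓝 z :=
  Filter.mem_of_superset (isOpen_ball.mem_nhds hz) ball_subset_closedBall

theorem exists_norm_fderiv_le {n : ℕ} {F : Type*} [NormedAddCommGroup F] [NormedSpace ℝ F]
    {c : Cn n} {δ : ℝ} (hδ : 0 < δ) {φ : Cn n → F} (hφ : ContDiffOn ℝ ∞ φ (closedBall c δ)) :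
    ∃ K : ℝ, ∀ z ∈ ball c δ, ‖φ z‖ ≤ K ∧ ‖fderiv ℝ φ z‖ ≤ K := by
  obtain ⟨K₁, h₁⟩ := (isCompact_closedBall c δ).exists_bound_of_continuousOn hφ.continuousOn
  obtain ⟨K₂, h₂⟩ := (isCompact_closedBall c δ).exists_bound_of_continuousOn
    (hφ.continuousOn_fderivWithin (uniqueDiffOn_closedBall c hδ) (by simp))
  refine ⟨max K₁ K₂, fun z hz => ⟨(h₁ z (ball_subset_closedBall hz)).trans (le_max_left _ _), ?_⟩⟩
  rw [← fderivWithin_of_mem_nhds (closedBall_mem_nhds_of_mem_ball hz)]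
  exact (h₂ z (ball_subset_closedBall hz)).trans (le_max_right _ _)

theorem exists_matrix_norm_fderiv_le {n : ℕ} {c : Cn n} {δ : ℝ} (hδ : 0 < δ)
    {φ : Cn n → Matrix (Fin n) (Fin n) ℂ}
    (hφ : ∀ i j, ContDiffOn ℝ ∞ (fun z => φ z i j) (closedBall c δ)) :
    ∃ K : ℝ, ∀ z ∈ ball c δ, ∀ i j, ‖φ z i j‖ ≤ K ∧ ‖fderiv ℝ (fun x => φ x i j) z‖ ≤ K := by
  choose K hK using fun i j => exists_norm_fderiv_le hδ (hφ i j)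
  have hle : ∀ i j, K i j ≤ ∑ i, ∑ j, |K i j| := fun i j =>
    (le_abs_self _).trans <|
      (Finset.single_le_sum (f := fun j => |K i j|) (fun _ _ => abs_nonneg _)
        (Finset.mem_univ j)).trans
      (Finset.single_le_sum (f := fun i => ∑ j, |K i j|)
        (fun _ _ => Finset.sum_nonneg fun _ _ => abs_nonneg _) (Finset.mem_univ i))
  exact ⟨∑ i, ∑ j, |K i j|, fun z hz i j =>
    ⟨(hK i j z hz).1.trans (hle i j), (hK i j z hz).2.trans (hle i j)⟩⟩

theorem Matrix.PosDef.re_sform_pos {n : ℕ} {a : Matrix (Fin n) (Fin n) ℂ} (ha : a.PosDef)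
    {v : Cn n} (hv : v ≠ 0) : 0 < (sform a v v).re := by
  have hx : star v.ofLp ≠ 0 := by
    rw [Ne, star_eq_zero]
    exact fun h => hv (by ext i; simp [h])
  have h := ha.re_dotProduct_pos hx
  rw [star_star] at h
  rw [sform_eq_dotProduct]
  exact h

theorem re_sform_real_smul {n : ℕ} (M : Matrix (Fin n) (Fin n) ℂ) (r : ℝ) (v : Cn n) :
    (sform M (r • v) (r • v)).re = r ^ 2 * (sform M v v).re := by
  have : sform M (r • v) (r • v) = ((r ^ 2 : ℝ) : ℂ) * sform M v v := by
    simp only [sform, Finset.mul_sum]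
    refine Finset.sum_congr rfl fun i _ => Finset.sum_congr rfl fun j _ => ?_
    simp
    ring
  rw [this, Complex.re_ofReal_mul]

theorem exists_pos_lower_bound {n : ℕ} {S : Set (Cn n)} (hS : IsCompact S)
    {α : Cn n → Matrix (Fin n) (Fin n) ℂ} (hα : ∀ i j, ContinuousOn (fun z => α z i j) S)
    (hpos : ∀ z ∈ S, (α z).PosDef) :
    ∃ c₀ : ℝ, 0 < c₀ ∧ ∀ z ∈ S, ∀ v : Cn n, c₀ * ‖v‖ ^ 2 ≤ (sform (α z) v v).re := by
  have hcomp : IsCompact (S ×ˢ sphere (0 : Cn n) 1) := hS.prod (isCompact_sphere 0 1)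
  have hcont : ContinuousOn (fun p : Cn n × Cn n => (sform (α p.1) p.2 p.2).re)
      (S ×ˢ sphere (0 : Cn n) 1) := by
    refine Complex.continuous_re.comp_continuousOn ?_
    refine continuousOn_finsetSum _ fun i _ => continuousOn_finsetSum _ fun j _ => ?_
    refine (ContinuousOn.mul ((hα i j).comp continuousOn_fst fun p hp => hp.1) ?_).mul ?_
    · fun_prop
    · fun_prop
  have key : ∃ c₀ : ℝ, 0 < c₀ ∧ ∀ p ∈ S ×ˢ sphere (0 : Cn n) 1,
      c₀ ≤ (sform (α p.1) p.2 p.2).re := by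
    rcases (S ×ˢ sphere (0 : Cn n) 1).eq_empty_or_nonempty with h | h
    · exact ⟨1, one_pos, by simp [h]⟩
    · obtain ⟨p, hp, hmin⟩ := hcomp.exists_isMinOn h hcont
      refine ⟨_, (hpos p.1 hp.1).re_sform_pos (v := p.2) ?_, fun q hq => hmin hq⟩
      exact ne_zero_of_mem_unit_sphere (⟨p.2, hp.2⟩ : sphere (0 : Cn n) 1)
  obtain ⟨c₀, h0, h1⟩ := key
  refine ⟨c₀, h0, fun z hz v => ?_⟩
  rcases eq_or_ne v 0 with rfl | hv
  · simp [sform]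
  · have hn : ‖v‖ ≠ 0 := norm_ne_zero_iff.mpr hv
    have h2 := h1 (z, ‖v‖⁻¹ • v) ⟨hz, by simp [norm_smul, hn]⟩
    rw [re_sform_real_smul] at h2
    calc c₀ * ‖v‖ ^ 2 ≤ (‖v‖⁻¹ ^ 2 * (sform (α z) v v).re) * ‖v‖ ^ 2 := by gcongr
      _ = (sform (α z) v v).re := by field_simp

/-- Tangential derivatives of a function vanishing on the sphere vanish. -/
theorem fderivWithin_tangential_eq_zero {n : ℕ} {c z ξ : Cn n} {δ : ℝ} {u : Cn n → ℝ}
    (hδ : 0 < δ) (hu : DifferentiableWithinAt ℝ u (closedBall c δ) z)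
    (hu0 : ∀ x ∈ sphere c δ, u x = 0) (hz : z ∈ sphere c δ) (hξ : inner ℝ (z - c) ξ = 0) :
    fderivWithin ℝ u (closedBall c δ) z ξ = 0 := by
  rcases eq_or_ne ξ 0 with rfl | hξ0
  · simp
  have hξn : ‖ξ‖ ≠ 0 := norm_ne_zero_iff.mpr hξ0
  set η : Cn n := (δ / ‖ξ‖) • ξ with hη
  have hηn : ‖η‖ = δ := by
    rw [hη, norm_smul, Real.norm_of_nonneg (by positivity)]
    field_simp
  have hzn : ‖z - c‖ = δ := by simpa [dist_eq_norm] using hz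
  have hin : inner ℝ (z - c) η = 0 := by rw [hη, real_inner_smul_right, hξ, mul_zero]
  have hγ : HasDerivAt (fun t : ℝ => c + (Real.cos t • (z - c) + Real.sin t • η)) η 0 := by
    have h1 := (((Real.hasDerivAt_cos 0).smul_const (z - c)).add
      ((Real.hasDerivAt_sin 0).smul_const η)).const_add c
    simpa using h1
  have hγs : ∀ t : ℝ, c + (Real.cos t • (z - c) + Real.sin t • η) ∈ sphere c δ := fun t => by
    rw [mem_sphere, dist_eq_norm, add_sub_cancel_left, ← sq_eq_sq₀ (norm_nonneg _) hδ.le,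
      norm_add_sq_real, norm_smul, norm_smul, real_inner_smul_left, real_inner_smul_right, hin,
      hzn, hηn, mul_pow, mul_pow, Real.norm_eq_abs, Real.norm_eq_abs, sq_abs, sq_abs]
    linear_combination δ ^ 2 * Real.sin_sq_add_cos_sq t
  have e0 : c + (Real.cos 0 • (z - c) + Real.sin 0 • η) = z := by simp
  have h1 := HasFDerivWithinAt.comp_hasDerivAt_of_eq (0 : ℝ) hu.hasFDerivWithinAt hγ
    (Filter.Eventually.of_forall fun t => sphere_subset_closedBall (hγs t)) e0.symm
  have h2 : (u ∘ fun t : ℝ => c + (Real.cos t • (z - c) + Real.sin t • η)) = fun _ => 0 :=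
    funext fun t => hu0 _ (hγs t)
  rw [h2] at h1
  have h3 := h1.unique (hasDerivAt_const (0 : ℝ) (0 : ℝ))
  rw [hη, map_smul, smul_eq_mul] at h3
  exact (mul_eq_zero.mp h3).resolve_left (by positivity)

end Compactness

/-! ### The boundary estimate -/

section Boundary

open Topology Matrix

/-- A barrier function without interior maxima near the boundary point `0` is nonpositive. -/
theorem barrier_nonpos {n : ℕ} {c : Cn n} {δ M A B : ℝ} {u : Cn n → ℝ}
    {t : Bool × Fin n × Fin n → ℝ} (hδ : 0 < δ) (hc : ‖c‖ = δ)
    (hu : ContDiffOn ℝ ∞ u (closedBall c δ)) (hu0 : ∀ z ∈ sphere c δ, u z = 0)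
    (hM : ∀ z ∈ closedBall c δ, ‖fderivWithin ℝ u (closedBall c δ) z‖ ≤ M)
    (ht : ∀ τ, |t τ| ≤ 1) (hA : 0 ≤ A) (hB : 0 ≤ B)
    (hBM : Fintype.card (Bool × Fin n × Fin n) * (M * (2 * δ) + (M * (2 * δ)) ^ 2) ≤
      B * (δ / 2) ^ 2)
    (hno : ∀ z ∈ ball c δ, δ / 2 ≤ ‖z - c‖ → ¬ IsLocalMax (fun x =>
      ∑ τ : Bool × Fin n × Fin n, (t τ * fderiv ℝ u x (gen τ (x - c)) +
        fderiv ℝ u x (gen τ (x - c)) ^ 2) + A * (‖x - c‖ ^ 2 - δ ^ 2) - B * ‖x‖ ^ 2) z) :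
    ∀ z ∈ closedBall c δ, ∑ τ : Bool × Fin n × Fin n,
      (t τ * fderivWithin ℝ u (closedBall c δ) z (gen τ (z - c)) +
        fderivWithin ℝ u (closedBall c δ) z (gen τ (z - c)) ^ 2) +
        A * (‖z - c‖ ^ 2 - δ ^ 2) - B * ‖z‖ ^ 2 ≤ 0 := by
  set W : Cn n → ℝ := fun z => ∑ τ : Bool × Fin n × Fin n,
      (t τ * fderivWithin ℝ u (closedBall c δ) z (gen τ (z - c)) +
        fderivWithin ℝ u (closedBall c δ) z (gen τ (z - c)) ^ 2) +
        A * (‖z - c‖ ^ 2 - δ ^ 2) - B * ‖z‖ ^ 2 with hW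
  have hDu := hu.continuousOn_fderivWithin (uniqueDiffOn_closedBall c hδ) (by simp)
  have hv : ∀ τ : Bool × Fin n × Fin n, ContinuousOn
      (fun z => fderivWithin ℝ u (closedBall c δ) z (gen τ (z - c))) (closedBall c δ) := fun τ =>
    hDu.clm_apply (by fun_prop)
  have hWc : ContinuousOn W (closedBall c δ) := by
    refine ((continuousOn_finsetSum _ fun τ _ => ?_).add (by fun_prop)).sub (by fun_prop)
    exact (continuousOn_const.mul (hv τ)).add ((hv τ).pow 2)
  obtain ⟨z, hz, hmax⟩ := (isCompact_closedBall c δ).exists_isMaxOn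
    ⟨c, mem_closedBall_self hδ.le⟩ hWc
  suffices hWz : W z ≤ 0 from fun x hx => (hmax hx).trans hWz
  have hzn : ‖z - c‖ ≤ δ := by simpa [dist_eq_norm] using hz
  by_cases hsph : z ∈ sphere c δ
  · have hzn' : ‖z - c‖ = δ := by simpa [dist_eq_norm] using hsph
    have h0 : ∀ τ, fderivWithin ℝ u (closedBall c δ) z (gen τ (z - c)) = 0 := fun τ =>
      fderivWithin_tangential_eq_zero hδ (hu.differentiableOn (by simp) z hz) hu0 hsph
        (real_inner_gen_self τ _)
    have : W z = - (B * ‖z‖ ^ 2) := by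
      simp only [hW, h0, hzn']
      simp
    rw [this]
    exact neg_nonpos.mpr (by positivity)
  by_cases hfar : δ / 2 ≤ ‖z‖
  · have hM0 : 0 ≤ M := (norm_nonneg _).trans (hM z hz)
    have hvb : ∀ τ, |fderivWithin ℝ u (closedBall c δ) z (gen τ (z - c))| ≤ M * (2 * δ) :=
      fun τ => by
        refine ((fderivWithin ℝ u (closedBall c δ) z).le_opNorm _).trans ?_
        exact mul_le_mul (hM z hz) ((norm_gen_apply_le τ _).trans (by linarith))
          (norm_nonneg _) hM0
    have h1 : ∑ τ : Bool × Fin n × Fin n,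
        (t τ * fderivWithin ℝ u (closedBall c δ) z (gen τ (z - c)) +
          fderivWithin ℝ u (closedBall c δ) z (gen τ (z - c)) ^ 2) ≤
        Fintype.card (Bool × Fin n × Fin n) * (M * (2 * δ) + (M * (2 * δ)) ^ 2) := by
      refine (Finset.sum_le_sum (g := fun _ => M * (2 * δ) + (M * (2 * δ)) ^ 2)
        fun τ _ => add_le_add ?_ ?_).trans (le_of_eq (by
          rw [Finset.sum_const, Finset.card_univ, nsmul_eq_mul]))
      · refine (le_abs_self _).trans ?_
        rw [abs_mul]
        exact (mul_le_of_le_one_left (abs_nonneg _) (ht τ)).trans (hvb τ)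
      · rw [← sq_abs]
        exact pow_le_pow_left₀ (abs_nonneg _) (hvb τ) 2
    have h2 : B * (δ / 2) ^ 2 ≤ B * ‖z‖ ^ 2 := by gcongr
    have h3 : A * (‖z - c‖ ^ 2 - δ ^ 2) ≤ 0 :=
      mul_nonpos_of_nonneg_of_nonpos hA (sub_nonpos.mpr (by gcongr))
    simp only [hW]
    linarith
  · exfalso
    push Not at hfar
    have hzb : z ∈ ball c δ := by
      rcases lt_or_eq_of_le (mem_closedBall.mp hz) with h | h
      · exact h
      · exact absurd h hsph
    refine hno z hzb ?_ ?_
    · have := norm_sub_norm_le c z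
      rw [norm_sub_rev c z, hc] at this
      linarith
    · have hloc := hmax.isLocalMax (closedBall_mem_nhds_of_mem_ball hzb)
      refine (Filter.EventuallyEq.isLocalMax_iff ?_).mp hloc
      filter_upwards [isOpen_ball.mem_nhds hzb] with x hx
      simp only [hW, fderivWithin_of_mem_nhds (closedBall_mem_nhds_of_mem_ball hx)]

/-- The normal derivative of the barrier at a boundary zero. -/
theorem barrier_normal_derivative_nonpos {n : ℕ} {c : Cn n} {δ A B : ℝ} {u : Cn n → ℝ}
    {t : Bool × Fin n × Fin n → ℝ} (hδ : 0 < δ) (hc : ‖c‖ = δ)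
    (hu : ContDiffOn ℝ ∞ u (closedBall c δ)) (hu0 : ∀ z ∈ sphere c δ, u z = 0)
    (hW : ∀ z ∈ closedBall c δ, ∑ τ : Bool × Fin n × Fin n,
      (t τ * fderivWithin ℝ u (closedBall c δ) z (gen τ (z - c)) +
        fderivWithin ℝ u (closedBall c δ) z (gen τ (z - c)) ^ 2) +
        A * (‖z - c‖ ^ 2 - δ ^ 2) - B * ‖z‖ ^ 2 ≤ 0) :
    -∑ τ, t τ *
      fderivWithin ℝ (fderivWithin ℝ u (closedBall c δ)) (closedBall c δ) 0 c (gen τ c) ≤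
      2 * A * δ ^ 2 := by
  set S := closedBall c δ with hS
  have h0S : (0 : Cn n) ∈ sphere c δ := by simp [hc]
  have h0 : (0 : Cn n) ∈ S := sphere_subset_closedBall h0S
  have hv0 : ∀ τ, fderivWithin ℝ u S 0 (gen τ (0 - c)) = 0 := fun τ =>
    fderivWithin_tangential_eq_zero hδ (hu.differentiableOn (by simp) 0 h0) hu0 h0S
      (real_inner_gen_self τ _)
  have hDu : HasFDerivWithinAt (fderivWithin ℝ u S)
      (fderivWithin ℝ (fderivWithin ℝ u S) S 0) S 0 :=
    (((hu.fderivWithin (m := ∞) (uniqueDiffOn_closedBall c hδ) (by simp)).differentiableOn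
      (by simp)) 0 h0).hasFDerivWithinAt
  have hid : HasFDerivWithinAt (fun z : Cn n => z - c) (ContinuousLinearMap.id ℝ (Cn n)) S 0 :=
    (hasFDerivWithinAt_id (𝕜 := ℝ) (0 : Cn n) S).sub_const c
  have hv : ∀ τ : Bool × Fin n × Fin n, HasFDerivWithinAt
      (fun z => fderivWithin ℝ u S z (gen τ (z - c))) _ S 0 := fun τ =>
    hDu.clm_apply (((gen τ).restrictScalars ℝ).hasFDerivAt.comp_hasFDerivWithinAt 0 hid)
  have hder := ((HasFDerivWithinAt.fun_sum (u := Finset.univ) fun τ _ =>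
    ((hv τ).const_mul (t τ)).add ((hv τ).pow 2)).add
    ((hid.norm_sq.sub_const (δ ^ 2)).const_mul A)).sub
    ((hasFDerivWithinAt_id (𝕜 := ℝ) (0 : Cn n) S).norm_sq.const_mul B)
  have hmax : IsLocalMaxOn (fun z => ∑ τ : Bool × Fin n × Fin n,
      (t τ * fderivWithin ℝ u S z (gen τ (z - c)) +
        fderivWithin ℝ u S z (gen τ (z - c)) ^ 2) +
        A * (‖z - c‖ ^ 2 - δ ^ 2) - B * ‖z‖ ^ 2) S 0 := by
    refine IsMaxOn.localize fun z hz => ?_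
    refine (hW z hz).trans (le_of_eq ?_)
    simp only [hv0]
    simp [hc]
  have hcone : c ∈ posTangentConeAt S 0 := by
    refine mem_posTangentConeAt_of_segment_subset ?_
    rw [zero_add]
    exact (convex_closedBall c δ).segment_subset h0 (mem_closedBall_self hδ.le)
  have hle := hmax.hasFDerivWithinAt_nonpos hder hcone
  have hv0' : ∀ τ, fderivWithin ℝ u S 0 (gen τ c) = 0 := fun τ => by simpa using hv0 τ
  simp [hc, hv0'] at hle
  linarith

end Boundary

section RotationBound

open Topology Matrix

theorem norm_fderivWithin_closedBall_le {n : ℕ} {c : Cn n} {δ M : ℝ} (hδ : 0 < δ) {u : Cn n → ℝ}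
    (hu : ContDiffOn ℝ ∞ u (closedBall c δ)) (hM : ∀ z ∈ ball c δ, ‖fderiv ℝ u z‖ ≤ M) :
    ∀ z ∈ closedBall c δ, ‖fderivWithin ℝ u (closedBall c δ) z‖ ≤ M := by
  intro z hz
  have hcont := hu.continuousOn_fderivWithin (uniqueDiffOn_closedBall c hδ) (by simp)
  rw [← closure_ball c hδ.ne'] at hz
  refine le_on_closure (f := fun z => ‖fderivWithin ℝ u (closedBall c δ) z‖) (g := fun _ => M)
    (fun x hx => ?_) ?_ continuousOn_const hz
  · rw [fderivWithin_of_mem_nhds (closedBall_mem_nhds_of_mem_ball hx)]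
    exact hM x hx
  · rw [closure_ball c hδ.ne']
    exact hcont.norm

/-- The mixed second derivatives at the boundary point `0` in the normal direction and along the
infinitesimal rotations about the centre are bounded uniformly in the solution. -/
theorem exists_rotation_bound {n k : ℕ} (hkn : k + 1 ≤ n) {c : Cn n} {δ : ℝ} (hδ : 0 < δ)
    (hc : ‖c‖ = δ) {α χ : Cn n → Matrix (Fin n) (Fin n) ℂ}
    (hα : IsHermitianMetricOn α (closedBall c δ)) (hχ : IsRealFormOn χ (closedBall c δ))
    {f : Cn n → ℝ} (hf : ContDiffOn ℝ ∞ f (closedBall c δ))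
    (hfpos : ∀ z ∈ closedBall c δ, 0 < f z) (M : ℝ) :
    ∃ C : ℝ, ∀ u : Cn n → ℝ, ContDiffOn ℝ ∞ u (closedBall c δ) →
      IsAdmissibleSolutionOn (k + 1) α χ (closedBall c δ) u f (ball c δ) →
      (∀ z ∈ sphere c δ, u z = 0) → (∀ z ∈ ball c δ, ‖fderiv ℝ u z‖ ≤ M) →
      ∀ τ, |fderivWithin ℝ (fderivWithin ℝ u (closedBall c δ)) (closedBall c δ) 0 c (gen τ c)| ≤
        C := by
  obtain ⟨Kα, hKα⟩ := exists_matrix_norm_fderiv_le hδ hα.1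
  obtain ⟨Kχ, hKχ⟩ := exists_matrix_norm_fderiv_le hδ hχ.1
  obtain ⟨Kf, hKf⟩ := exists_norm_fderiv_le hδ hf
  obtain ⟨c₀, hc₀, hαc₀⟩ := exists_pos_lower_bound (isCompact_closedBall c δ)
    (fun i j => (hα.1 i j).continuousOn) hα.2
  obtain ⟨zmin, hzmin, hmin⟩ := (isCompact_closedBall c δ).exists_isMinOn
    ⟨c, mem_closedBall_self hδ.le⟩ hf.continuousOn
  set K : ℝ := max (max |Kα| |Kχ|) |Kf| + 1 with hK
  have hK0 : 0 < K := by positivity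
  have hKαK : Kα ≤ K := by
    linarith [le_abs_self Kα, le_max_left |Kα| |Kχ|, le_max_left (max |Kα| |Kχ|) |Kf|]
  have hKχK : Kχ ≤ K := by
    linarith [le_abs_self Kχ, le_max_right |Kα| |Kχ|, le_max_left (max |Kα| |Kχ|) |Kf|]
  have hKfK : Kf ≤ K := by
    linarith [le_abs_self Kf, le_max_right (max |Kα| |Kχ|) |Kf|]
  obtain ⟨D, hD0, hD⟩ := exists_barrier_constant n k hkn (K := K) (c₀ := c₀) (d := δ)
    (d₀ := δ / 2) (M := M) (κ := min 1 (f zmin)) (C₃ := (k + 1) * K) hK0 hc₀ (by positivity)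
    (lt_min one_pos (hfpos zmin hzmin)) (min_le_left _ _) (by positivity)
  set B : ℝ := |Fintype.card (Bool × Fin n × Fin n) * (M * (2 * δ) + (M * (2 * δ)) ^ 2)| /
    (δ / 2) ^ 2 with hB
  have hB0 : 0 ≤ B := by positivity
  have hBM : Fintype.card (Bool × Fin n × Fin n) * (M * (2 * δ) + (M * (2 * δ)) ^ 2) ≤
      B * (δ / 2) ^ 2 := by
    rw [hB, div_mul_cancel₀ _ (by positivity)]
    exact le_abs_self _
  refine ⟨2 * (D + B) * δ ^ 2, fun u hu hsol hu0 hM => ?_⟩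
  have hbound : ∀ t : Bool × Fin n × Fin n → ℝ, (∀ τ, |t τ| ≤ 1) → -∑ τ, t τ *
      fderivWithin ℝ (fderivWithin ℝ u (closedBall c δ)) (closedBall c δ) 0 c (gen τ c) ≤
      2 * (D + B) * δ ^ 2 := by
    intro t ht
    refine barrier_normal_derivative_nonpos hδ hc hu hu0 (B := B)
      (barrier_nonpos hδ hc hu hu0 (norm_fderivWithin_closedBall_le hδ hu hM) ht (by positivity)
        hB0 hBM fun z hz hzc => ?_)
    have hnhds := closedBall_mem_nhds_of_mem_ball hz
    have hzS := ball_subset_closedBall hz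
    have hball := isOpen_ball.mem_nhds hz
    refine hD (D + B) B (δ ^ 2) t (closedBall c δ) α χ u f c z (by linarith) ht hnhds
      (contDiffAt_infty.mp (hu.contDiffAt hnhds) 3)
      (fun i j => ((hα.1 i j).contDiffAt hnhds).differentiableAt (by simp))
      (fun i j => ((hχ.1 i j).contDiffAt hnhds).differentiableAt (by simp))
      ((hf.contDiffAt hnhds).differentiableAt (by simp))
      (Filter.mem_of_superset hnhds hα.2) (hχ.2 z hzS) (Filter.mem_of_superset hball hsol)
      (fun i j => (hKα z hz i j).1.trans hKαK) (fun i j => (hKχ z hz i j).1.trans hKχK)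
      (fun i j => (hKα z hz i j).2.trans hKαK) (fun i j => (hKχ z hz i j).2.trans hKχK)
      ((hKf z hz).2.trans hKfK) (hαc₀ z hzS) (hM z hz) ((min_le_right _ _).trans (hmin hzS)) ?_
      hzc (by simpa [dist_eq_norm] using hzS)
    have : f z ≤ K := (le_abs_self _).trans ((hKf z hz).1.trans hKfK)
    gcongr
  intro τ
  have hpos := hbound (Pi.single τ 1) fun σ => by
    rw [Pi.single_apply]; split_ifs <;> simp
  have hneg := hbound (Pi.single τ (-1)) fun σ => by
    rw [Pi.single_apply]; split_ifs <;> simp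
  simp only [Pi.single_apply, ite_mul, zero_mul, Finset.sum_ite_eq',
    Finset.mem_univ, if_true] at hpos hneg
  rw [abs_le]
  constructor <;> linarith

theorem D2On_eq_fderivWithin_fderivWithin {n : ℕ} {s : Set (Cn n)} (hs : UniqueDiffOn ℝ s)
    {u : Cn n → ℝ} (hu : ContDiffOn ℝ ∞ u s) {z : Cn n} (hz : z ∈ s) (v w : Cn n) :
    D2On s u v w z = fderivWithin ℝ (fderivWithin ℝ u s) s z w v := by
  have hDu := ((hu.fderivWithin (m := ∞) hs (by simp)).differentiableOn
    (by simp) z hz).hasFDerivWithinAt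
  rw [D2On, (hDu.clm_apply (hasFDerivWithinAt_const v z s)).fderivWithin (hs z hz)]
  simp

end RotationBound

/-- Tangential-normal boundary `C²`-estimate at the boundary point `P = 0`
of the ball `Ω = B(c, δ)`, where `c = δ·e_n`, so that the positive `x_n`-axis is the interior
normal direction at `P`.  The tangential directions `t_1, …, t_{2n-1}` are
`x_1, y_1, …, x_{n-1}, y_{n-1}, y_n` and the normal one is `t_{2n} = x_n`. -/
theorem stmt4 (n m : ℕ) (hn : 2 ≤ n) (hm : 1 ≤ m) (hmn : m ≤ n)
    (i₀ : Fin n) (hi₀ : (i₀ : ℕ) = n - 1)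
    (δ : ℝ) (hδ : 0 < δ)
    (c : Cn n) (hc : c = EuclideanSpace.single i₀ (δ : ℂ))
    (α χ : Cn n → Matrix (Fin n) (Fin n) ℂ)
    (hα : IsHermitianMetricOn α (closedBall c δ))
    (hχ : IsRealFormOn χ (closedBall c δ))
    (hχα : ∀ z ∈ closedBall c δ, (χ z - α z).PosSemidef)
    (h : Cn n → ℝ) (hh : ContDiffOn ℝ ∞ h (closedBall c δ))
    (hhpos : ∀ z ∈ closedBall c δ, 0 < h z)
    (M₁ M₂ : ℝ) :
    ∃ C : ℝ,
      ∀ u : Cn n → ℝ, ContDiffOn ℝ ∞ u (closedBall c δ) →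
        IsAdmissibleSolutionOn m α χ (closedBall c δ) u (fun z => h z ^ m) (ball c δ) →
        (∀ z ∈ sphere c δ, u z = 0) →
        (∀ z ∈ closedBall c δ, 0 ≤ u z ∧ u z ≤ M₁) →
        (∀ z ∈ ball c δ, ‖fderiv ℝ u z‖ ≤ M₂) →
        ∀ k : Fin n,
          |D2On (closedBall c δ) u (EuclideanSpace.single k Complex.I)
              (EuclideanSpace.single i₀ 1) 0| ≤ C ∧
          (k ≠ i₀ →
            |D2On (closedBall c δ) u (EuclideanSpace.single k 1)
                (EuclideanSpace.single i₀ 1) 0| ≤ C) := by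
  have hcn : ‖c‖ = δ := by
    rw [hc, PiLp.norm_single, Complex.norm_real, Real.norm_of_nonneg hδ.le]
  have h0 : (0 : Cn n) ∈ closedBall c δ := by simp [hcn]
  obtain ⟨k, rfl⟩ : ∃ k, m = k + 1 := ⟨m - 1, by omega⟩
  obtain ⟨C, hC⟩ := exists_rotation_bound hmn hδ hcn hα hχ (hh.pow (k + 1))
    (fun z hz => pow_pos (hhpos z hz) _) M₂
  refine ⟨C / δ ^ 2, fun u hu hsol hu0 _ hM j => ?_⟩
  have hbound : ∀ (v : Cn n) (τ : Bool × Fin n × Fin n) (r : ℝ), 1 ≤ r →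
      gen τ c = (r * δ) • v →
      |D2On (closedBall c δ) u v (EuclideanSpace.single i₀ 1) 0| ≤ C / δ ^ 2 := by
    intro v τ r hr hv
    have hcv : c = δ • (EuclideanSpace.single i₀ (1 : ℂ) : Cn n) := by
      ext i
      simp [hc]
    have h1 := hC u hu hsol hu0 hM τ
    rw [D2On_eq_fderivWithin_fderivWithin (uniqueDiffOn_closedBall c hδ) hu h0,
      le_div_iff₀ (by positivity)]
    set Q := fderivWithin ℝ (fderivWithin ℝ u (closedBall c δ)) (closedBall c δ) 0
    have hQ : Q c = δ • Q (EuclideanSpace.single i₀ 1) :=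
      (congrArg Q hcv).trans (Q.map_smul δ _)
    rw [hv, hQ, smul_apply, map_smul, smul_eq_mul, smul_eq_mul, abs_mul,
      abs_mul, abs_of_pos hδ, abs_of_pos (by positivity)] at h1
    have hr' := mul_le_mul_of_nonneg_right hr
      (mul_nonneg (abs_nonneg (Q (EuclideanSpace.single i₀ 1) v)) (sq_nonneg δ))
    nlinarith
  constructor
  · by_cases hj : j = i₀
    · refine hbound _ (true, j, i₀) 2 one_le_two ?_
      rw [gen_true_apply, hj, hc]
      ext i
      by_cases hi : i = i₀ <;> simp [hi]
      ring
    · refine hbound _ (true, j, i₀) 1 le_rfl ?_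
      rw [gen_true_apply, hc]
      ext i
      by_cases hi : i = j <;> simp [hi, hj]
      ring
  · intro hj
    refine hbound _ (false, j, i₀) 1 le_rfl ?_
    rw [gen_false_apply, hc]
    ext i
    by_cases hi : i = j <;> simp [hi, hj]
end
end

section
/- There exists an index s ∈ {1,…,n} such that Σ_{k=1}^{n−1} Σ_{j,p} L^{p̄ j} g_{k p̄} g_{j k̄} ≥ (min_i τ_i / 2) · Σ_{i ≠ s} f_i λ_i². -/
open scoped BigOperators

noncomputable section

/-- Contracting `∑ a, conj (Y p a) f a Y j a` with `∑ b, X b k lam b conj (X b p)` on both sides,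
where `Y` is a right inverse of `X`, gives a diagonal expression. -/
theorem sum_contraction_eq {ι : Type*} [Fintype ι] [DecidableEq ι] {X Y : Matrix ι ι ℂ}
    (hXY : X * Y = 1) (f lam : ι → ℝ) {L G : Matrix ι ι ℂ}
    (hL : ∀ p j, L p j = ∑ a, (starRingEnd ℂ) (Y p a) * (f a : ℂ) * Y j a)
    (hG : ∀ k p, G k p = ∑ b, X b k * (lam b : ℂ) * (starRingEnd ℂ) (X b p)) (k : ι) :
    ∑ j, ∑ p, L p j * G k p * G j k =
      ((∑ a, f a * lam a ^ 2 * Complex.normSq (X a k) : ℝ) : ℂ) := by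
  have hentry (b a : ι) : ∑ p, X b p * Y p a = if b = a then 1 else 0 := by
    rw [← Matrix.mul_apply, hXY, Matrix.one_apply]
  have hleft (a : ι) : ∑ j, G j k * Y j a = lam a * (starRingEnd ℂ) (X a k) := by
    calc ∑ j, G j k * Y j a
        = ∑ b, lam b * (starRingEnd ℂ) (X b k) * ∑ j, X b j * Y j a := by
          simp only [hG, Finset.sum_mul, Finset.mul_sum]
          rw [Finset.sum_comm]
          refine Finset.sum_congr rfl fun b _ => Finset.sum_congr rfl fun j _ => ?_
          ring
      _ = lam a * (starRingEnd ℂ) (X a k) := by simp [hentry]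
  have hright (a : ι) : ∑ p, G k p * (starRingEnd ℂ) (Y p a) = lam a * X a k := by
    calc ∑ p, G k p * (starRingEnd ℂ) (Y p a)
        = ∑ b, lam b * X b k * (starRingEnd ℂ) (∑ p, X b p * Y p a) := by
          simp only [hG, Finset.sum_mul, Finset.mul_sum, map_sum, map_mul]
          rw [Finset.sum_comm]
          refine Finset.sum_congr rfl fun b _ => Finset.sum_congr rfl fun p _ => ?_
          ring
      _ = lam a * X a k := by simp [hentry]
  calc ∑ j, ∑ p, L p j * G k p * G j k
      = ∑ j, ∑ a, ∑ p, f a * ((G j k * Y j a) * (G k p * (starRingEnd ℂ) (Y p a))) := by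
        refine Finset.sum_congr rfl fun j _ => ?_
        rw [Finset.sum_comm]
        refine Finset.sum_congr rfl fun p _ => ?_
        rw [hL, Finset.sum_mul, Finset.sum_mul]
        refine Finset.sum_congr rfl fun a _ => ?_
        ring
    _ = ∑ a, f a * ((∑ j, G j k * Y j a) * ∑ p, G k p * (starRingEnd ℂ) (Y p a)) := by
        rw [Finset.sum_comm]
        refine Finset.sum_congr rfl fun a _ => ?_
        rw [Finset.sum_mul_sum]
        simp only [Finset.mul_sum]
    _ = ((∑ a, f a * lam a ^ 2 * Complex.normSq (X a k) : ℝ) : ℂ) := by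
        push_cast
        refine Finset.sum_congr rfl fun a _ => ?_
        rw [hleft, hright, Complex.normSq_eq_conj_mul_self]
        ring

theorem sum_normSq_row_of_mem_unitaryGroup {ι : Type*} [Fintype ι] [DecidableEq ι]
    {E : Matrix ι ι ℂ} (hE : E ∈ Matrix.unitaryGroup ι ℂ) (i : ι) :
    ∑ j, Complex.normSq (E i j) = 1 := by
  have h := congrFun (congrFun (Matrix.mem_unitaryGroup_iff.mp hE) i) i
  simp only [Matrix.mul_apply, Matrix.star_apply, Matrix.one_apply_eq] at h
  have h' : ((∑ j, Complex.normSq (E i j) : ℝ) : ℂ) = 1 := by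
    rw [← h]
    push_cast
    exact Finset.sum_congr rfl fun j _ => (Complex.mul_conj _).symm
  exact_mod_cast h'

theorem sum_normSq_col_of_mem_unitaryGroup {ι : Type*} [Fintype ι] [DecidableEq ι]
    {E : Matrix ι ι ℂ} (hE : E ∈ Matrix.unitaryGroup ι ℂ) (j : ι) :
    ∑ i, Complex.normSq (E i j) = 1 := by
  simpa [Matrix.star_apply] using
    sum_normSq_row_of_mem_unitaryGroup (Unitary.star_mem hE) j

/-- Among nonnegative weights of total mass one, all but at most one are at most `1 / 2`. -/
theorem exists_forall_ne_le_half {ι : Type*} [Fintype ι] [Nonempty ι] {w : ι → ℝ}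
    (hw : ∀ i, 0 ≤ w i) (hsum : ∑ i, w i = 1) : ∃ s, ∀ i, i ≠ s → w i ≤ 1 / 2 := by
  classical
  obtain ⟨s, hs⟩ := Finite.exists_max w
  refine ⟨s, fun i hi => ?_⟩
  have hpair : w i + w s ≤ ∑ i, w i := by
    rw [← Finset.sum_pair hi]
    exact Finset.sum_le_sum_of_subset_of_nonneg (Finset.subset_univ _) fun j _ _ => hw j
  linarith [hs i]

/-- (Key positivity estimate, cf. Guan.)  With `X = Λ^{1/2} E` for a
unitary `E` and `Λ = diag(τ)`, `L^{p̄ j} = Σ_a conj(x^{pa}) f_a x^{ja}` and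
`g_{k p̄} = Σ_b x_{bk} λ_b conj(x_{bp})`, there is an index `s` such that
`Σ_{k<n} Σ_{j,p} L^{p̄ j} g_{k p̄} g_{j k̄} ≥ (min_i τ_i / 2) Σ_{i ≠ s} f_i λ_i²`. -/
theorem stmt7 (n : ℕ) (hn : 2 ≤ n) (i₀ : Fin n) (hi₀ : (i₀ : ℕ) = n - 1)
    (τ : Fin n → ℝ) (hτ : ∀ i, 0 < τ i)
    (E : Matrix (Fin n) (Fin n) ℂ) (hE : E ∈ Matrix.unitaryGroup (Fin n) ℂ)
    (f lam : Fin n → ℝ) (hf : ∀ i, 0 ≤ f i)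
    (X : Matrix (Fin n) (Fin n) ℂ)
    (hX : ∀ i j, X i j = (Real.sqrt (τ i) : ℂ) * E i j)
    (L G : Matrix (Fin n) (Fin n) ℂ)
    (hL : ∀ p j, L p j = ∑ a, (starRingEnd ℂ) (X⁻¹ p a) * (f a : ℂ) * X⁻¹ j a)
    (hG : ∀ k p, G k p = ∑ b, X b k * (lam b : ℂ) * (starRingEnd ℂ) (X b p)) :
    ∃ s : Fin n,
      (Finset.univ.inf' (Finset.univ_nonempty_iff.mpr ⟨i₀⟩) τ / 2) *
          ∑ i ∈ Finset.univ.erase s, f i * lam i ^ 2 ≤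
        (∑ k ∈ Finset.univ.erase i₀, ∑ j, ∑ p, L p j * G k p * G j k).re := by
  have hne : Nonempty (Fin n) := ⟨i₀⟩
  have hinv : X * X⁻¹ = 1 := by
    have hright : X * (star E * Matrix.diagonal fun i => ((Real.sqrt (τ i))⁻¹ : ℂ)) = 1 := by
      have hXE : X = Matrix.diagonal (fun i => (Real.sqrt (τ i) : ℂ)) * E := by
        ext i j
        rw [hX, Matrix.diagonal_mul]
      rw [hXE, Matrix.mul_assoc, ← Matrix.mul_assoc E, Matrix.mem_unitaryGroup_iff.mp hE,
        Matrix.one_mul, Matrix.diagonal_mul_diagonal, ← Matrix.diagonal_one]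
      congr 1
      funext i
      exact mul_inv_cancel₀ (Complex.ofReal_ne_zero.mpr (Real.sqrt_pos.mpr (hτ i)).ne')
    rwa [Matrix.inv_eq_right_inv hright]
  obtain ⟨s, hs⟩ := exists_forall_ne_le_half (fun i => Complex.normSq_nonneg (E i i₀))
    (sum_normSq_col_of_mem_unitaryGroup hE i₀)
  refine ⟨s, ?_⟩
  have hnormSq (a k : Fin n) : Complex.normSq (X a k) = τ a * Complex.normSq (E a k) := by
    rw [hX, Complex.normSq_mul, Complex.normSq_ofReal, Real.mul_self_sqrt (hτ a).le]
  have hrow (a : Fin n) :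
      ∑ k ∈ Finset.univ.erase i₀, Complex.normSq (E a k) = 1 - Complex.normSq (E a i₀) := by
    rw [← sum_normSq_row_of_mem_unitaryGroup hE a,
      ← Finset.add_sum_erase _ _ (Finset.mem_univ i₀)]
    ring
  have hsum : (∑ k ∈ Finset.univ.erase i₀, ∑ j, ∑ p, L p j * G k p * G j k).re =
      ∑ a, f a * lam a ^ 2 *
        (τ a * ∑ k ∈ Finset.univ.erase i₀, Complex.normSq (E a k)) := by
    simp only [sum_contraction_eq hinv f lam hL hG]
    rw [← Complex.ofReal_sum, Complex.ofReal_re, Finset.sum_comm]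
    simp only [hnormSq, Finset.mul_sum]
  rw [hsum, Finset.mul_sum]
  have hweight (a : Fin n) : 0 ≤ f a * lam a ^ 2 := mul_nonneg (hf a) (sq_nonneg _)
  refine (Finset.sum_le_sum fun a ha => ?_).trans
    (Finset.sum_le_sum_of_subset_of_nonneg (Finset.erase_subset s _) fun a _ _ =>
      mul_nonneg (hweight a) (mul_nonneg (hτ a).le
        (Finset.sum_nonneg fun k _ => Complex.normSq_nonneg _)))
  rw [hrow, mul_comm]
  refine mul_le_mul_of_nonneg_left ?_ (hweight a)
  have hmin : Finset.univ.inf' (Finset.univ_nonempty_iff.mpr ⟨i₀⟩) τ ≤ τ a :=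
    Finset.inf'_le _ (Finset.mem_univ a)
  have hhalf := hs a (Finset.ne_of_mem_erase ha)
  nlinarith [hτ a]
end
end
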